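/- arXiv:1710.10018 — 5 statements merged into one kernel-verified Lean document; each statement's English description precedes it below -/
import Mathlib

section
/- Let X be a full subcategory of finitely generated R-modules such that: (i) every module in X is a first syzygy module; (ii) X is closed under first cosyzygies and under kernels of epimorphisms; (iii) the only modules in X of finite projective dimension are the projective modules. Then every module in X is totally reflexive. -/
open CategoryTheory

noncomputable section

namespace Paper

variable (R : Type) [CommRing R]

/-- finitely generated projective module (object of `add R`) -/
def FGProj (M : ModuleCat.{0} R) : Prop := Module.Finite R M ∧ Module.Projective R M

/-- a short exact sequence `0 → L → M → N → 0` -/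
def SES {L M N : ModuleCat.{0} R} (f : L →ₗ[R] M) (g : M →ₗ[R] N) : Prop :=
  Function.Injective f ∧ Function.Surjective g ∧ LinearMap.ker g = LinearMap.range f

/-- `N` is a first syzygy of `M`: kernel of a surjection from a f.g. projective onto `M`. -/
def IsSyzygy (N M : ModuleCat.{0} R) : Prop :=
  ∃ (P : ModuleCat.{0} R) (f : P →ₗ[R] M), FGProj R P ∧ Function.Surjective f ∧
    Nonempty (N ≃ₗ[R] LinearMap.ker f)

/-- `N` is an `n`-th syzygy of `M` -/
def IsNthSyzygy : ℕ → ModuleCat.{0} R → ModuleCat.{0} R → Prop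
  | 0, N, M => Nonempty (N ≃ₗ[R] M)
  | (n+1), N, M => ∃ K : ModuleCat.{0} R, IsNthSyzygy n K M ∧ IsSyzygy R N K

/-- `f : M → P` is a left `add R`-approximation -/
def IsLeftApprox {M P : ModuleCat.{0} R} (f : M →ₗ[R] P) : Prop :=
  FGProj R P ∧ ∀ (Q : ModuleCat.{0} R), FGProj R Q → ∀ g : M →ₗ[R] Q,
    ∃ h : P →ₗ[R] Q, h.comp f = g

/-- `N` is a first cosyzygy of `M`: cokernel of a left `add R`-approximation. -/
def IsCosyzygy (N M : ModuleCat.{0} R) : Prop :=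
  ∃ (P : ModuleCat.{0} R) (f : M →ₗ[R] P), IsLeftApprox R f ∧
    Nonempty (N ≃ₗ[R] (P ⧸ LinearMap.range f))

/-- `N` is an `n`-th cosyzygy of `M` -/
def IsNthCosyzygy : ℕ → ModuleCat.{0} R → ModuleCat.{0} R → Prop
  | 0, N, M => Nonempty (N ≃ₗ[R] M)
  | (n+1), N, M => ∃ K : ModuleCat.{0} R, IsNthCosyzygy n K M ∧ IsCosyzygy R N K

/-- `T` is an (Auslander) transpose of `M` -/
def IsTranspose (T M : ModuleCat.{0} R) : Prop :=
  ∃ (P₁ P₀ : ModuleCat.{0} R) (d : P₁ →ₗ[R] P₀) (p : P₀ →ₗ[R] M),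
    FGProj R P₁ ∧ FGProj R P₀ ∧ Function.Surjective p ∧
    LinearMap.ker p = LinearMap.range d ∧
    Nonempty (T ≃ₗ[R] ((Module.Dual R P₁) ⧸ LinearMap.range d.dualMap))

/-- stably isomorphic: `M ⊕ P ≅ N ⊕ Q` with `P`, `Q` f.g. projective -/
def StablyIso (M N : ModuleCat.{0} R) : Prop :=
  ∃ P Q : ModuleCat.{0} R, FGProj R P ∧ FGProj R Q ∧
    Nonempty ((M × P) ≃ₗ[R] (N × Q))

/-- resolving subcategory of `mod R` -/
structure Resolving (X : ModuleCat.{0} R → Prop) : Prop where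
  fg : ∀ M, X M → Module.Finite R M
  proj : ∀ M : ModuleCat.{0} R, FGProj R M → X M
  summand : ∀ M N N' : ModuleCat.{0} R, X M → Nonempty (M ≃ₗ[R] N × N') → X N
  extension : ∀ (L M N : ModuleCat.{0} R) (f : L →ₗ[R] M) (g : M →ₗ[R] N),
      SES R f g → X L → X N → X M
  ker_epi : ∀ (L M N : ModuleCat.{0} R) (f : L →ₗ[R] M) (g : M →ₗ[R] N),
      SES R f g → X M → X N → X L

/-- `Ext^i_R(M, N) = 0` -/
def ExtVanish (M N : ModuleCat.{0} R) (i : ℕ) : Prop :=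
  Subsingleton (((Ext R (ModuleCat.{0} R) i).obj (Opposite.op M)).obj N)

/-- totally reflexive (Gorenstein dimension zero) module -/
def TotallyReflexive (M : ModuleCat.{0} R) : Prop :=
  Function.Bijective (Module.Dual.eval R M) ∧
  ∀ i : ℕ, 0 < i → ExtVanish R M (ModuleCat.of R R) i ∧
    ExtVanish R (ModuleCat.of R (Module.Dual R M)) (ModuleCat.of R R) i

/-- `M` has finite projective dimension -/
def FiniteProjDim (M : ModuleCat.{0} R) : Prop :=
  ∃ (n : ℕ) (N : ModuleCat.{0} R), IsNthSyzygy R n N M ∧ FGProj R N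

/-- additive closure of a family of modules -/
def AddClosure (S : ModuleCat.{0} R → Prop) (M : ModuleCat.{0} R) : Prop :=
  ∃ (k : ℕ) (f : Fin k → ModuleCat.{0} R) (N : ModuleCat.{0} R),
    (∀ i, S (f i)) ∧ Nonempty ((M × N) ≃ₗ[R] ((i : Fin k) → f i))

/-- the operation `[−]`: `add` closure of `R` and all syzygies of modules of `Y` -/
def Bracket (Y : ModuleCat.{0} R → Prop) : ModuleCat.{0} R → Prop :=
  AddClosure R (fun N => FGProj R N ∨ ∃ (M : ModuleCat.{0} R) (i : ℕ), Y M ∧ IsNthSyzygy R i N M)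

/-- `Y ∘ Z`: extensions of a module of `Z` by a module of `Y` -/
def ExtOf (Y Z : ModuleCat.{0} R → Prop) (M : ModuleCat.{0} R) : Prop :=
  ∃ (A B : ModuleCat.{0} R) (f : A →ₗ[R] M) (g : M →ₗ[R] B), Y A ∧ Z B ∧ SES R f g

/-- the ball `[C]_n` of radius `n` centered at `C` -/
def Ball (C : ModuleCat.{0} R) : ℕ → ModuleCat.{0} R → Prop
  | 0 => fun _ => False
  | 1 => Bracket R (fun M => Nonempty (M ≃ₗ[R] C))
  | (n+2) => Bracket R (ExtOf R (Ball C (n+1)) (Bracket R (fun M => Nonempty (M ≃ₗ[R] C))))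

/-- `X` has finite radius: `X ⊆ [C]_{n+1}` for some `C ∈ X`. -/
def FiniteRadius (X : ModuleCat.{0} R → Prop) : Prop :=
  ∃ (C : ModuleCat.{0} R) (n : ℕ), X C ∧ ∀ M, X M → Ball R C (n + 1) M

/-- `depth_A M ≥ n`: there is a weakly `M`-regular sequence of length `n` in the maximal ideal -/
def DepthGE (A : Type) [CommRing A] [IsLocalRing A]
    (M : Type) [AddCommGroup M] [Module A M] (n : ℕ) : Prop :=
  ∃ rs : List A, rs.length = n ∧ (∀ x ∈ rs, x ∈ IsLocalRing.maximalIdeal A) ∧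
    RingTheory.Sequence.IsWeaklyRegular M rs

/-- `M` is free at the prime `p` -/
def FreeAt (M : ModuleCat.{0} R) (p : PrimeSpectrum R) : Prop :=
  Module.Free (Localization.AtPrime p.asIdeal) (LocalizedModule p.asIdeal.primeCompl M)

/-- locally free on the punctured spectrum of a local ring -/
def LocFreeOnPunctured [IsLocalRing R] (M : ModuleCat.{0} R) : Prop :=
  ∀ p : PrimeSpectrum R, p.asIdeal ≠ IsLocalRing.maximalIdeal R → FreeAt R M p

/-- a Gorenstein local ring: `R` has finite injective dimension over itself -/
def Gorenstein : Prop :=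
  ∃ n : ℕ, ∀ i : ℕ, n < i → ∀ M : ModuleCat.{0} R, ExtVanish R M (ModuleCat.of R R) i

/-- the annihilator of the `i`-th local cohomology module `H^i_I(M)` -/
def aa (I : Ideal R) (i : ℕ) (M : ModuleCat.{0} R) : Ideal R :=
  Module.annihilator R ((localCohomology I i).obj M)

/-- an Ulrich module over a CM local ring of dimension `d` -/
def Ulrich [IsLocalRing R] (d : ℕ) (U : ModuleCat.{0} R) : Prop :=
  Module.Finite R U ∧ DepthGE R U d ∧ ¬ Subsingleton U ∧
  ∃ xs : List R, xs.length = d ∧ (∀ x ∈ xs, x ∈ IsLocalRing.maximalIdeal R) ∧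
    RingTheory.Sequence.IsWeaklyRegular U xs ∧
    (IsLocalRing.maximalIdeal R) • (⊤ : Submodule R U) = Ideal.ofList xs • ⊤

end Paper

open Paper

namespace Aux

variable {R : Type} [CommRing R]

lemma isCosyzygy_of {M P N : ModuleCat.{0} R} (f : M →ₗ[R] P) (g : P →ₗ[R] N)
    (hf : IsLeftApprox R f) (hg : Function.Surjective g)
    (h : LinearMap.ker g = LinearMap.range f) : IsCosyzygy R N M := by
  refine ⟨P, f, hf, ?_⟩
  exact ⟨((Submodule.quotEquivOfEq _ _ h.symm).trans
    (g.quotKerEquivOfSurjective hg)).symm⟩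

lemma fgProj_prod (P Q : ModuleCat.{0} R) (hP : FGProj R P) (hQ : FGProj R Q) :
    FGProj R (ModuleCat.of R (P × Q)) := by
  obtain ⟨h1, h2⟩ := hP
  obtain ⟨h3, h4⟩ := hQ
  exact ⟨inferInstanceAs (Module.Finite R (P × Q)), inferInstanceAs (Module.Projective R (P × Q))⟩

lemma approx_prod {M P : ModuleCat.{0} R} (f : M →ₗ[R] P) (hf : IsLeftApprox R f)
    (Q : ModuleCat.{0} R) (hQ : FGProj R Q) :
    IsLeftApprox R (M := M) (P := ModuleCat.of R (P × Q)) (f.prod (0 : M →ₗ[R] Q)) := by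
  refine ⟨fgProj_prod P Q hf.1 hQ, fun Q' hQ' g => ?_⟩
  obtain ⟨h, hh⟩ := hf.2 Q' hQ' g
  refine ⟨h.comp (LinearMap.fst R P Q), ?_⟩
  rw [← hh]
  ext x
  rfl

lemma cosyz_prod {M P : ModuleCat.{0} R} (f : M →ₗ[R] P) (hf : IsLeftApprox R f)
    (Q : ModuleCat.{0} R) (hQ : FGProj R Q) :
    IsCosyzygy R (ModuleCat.of R ((P ⧸ LinearMap.range f) × Q)) M := by
  refine isCosyzygy_of (P := ModuleCat.of R (P × Q)) _
    (((LinearMap.range f).mkQ).prodMap (LinearMap.id : Q →ₗ[R] Q)) (approx_prod f hf Q hQ) ?_ ?_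
  · exact Function.Surjective.prodMap (Submodule.mkQ_surjective _) Function.surjective_id
  · ext ⟨p, q⟩
    constructor
    · intro h
      have h1 : (LinearMap.range f).mkQ p = 0 := congrArg Prod.fst h
      have h2 : q = 0 := congrArg Prod.snd h
      have h3 : p ∈ LinearMap.range f := by simpa using h1
      obtain ⟨m, rfl⟩ := h3
      exact ⟨m, by rw [h2]; rfl⟩
    · rintro ⟨m, hm⟩
      have h1 : f m = p := congrArg Prod.fst hm
      have h2 : 0 = q := congrArg Prod.snd hm
      subst h1; subst h2
      change ((LinearMap.range f).mkQ (f m), (0 : Q)) = 0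
      simp

/-- the basic diagram lemma -/
lemma diagram {K P M Q : Type} [AddCommGroup K] [Module R K] [AddCommGroup P] [Module R P]
    [AddCommGroup M] [Module R M] [AddCommGroup Q] [Module R Q]
    (v : K →ₗ[R] P) (w : M →ₗ[R] Q) (s : K →ₗ[R] M) (t : P →ₗ[R] Q)
    (hw : Function.Injective w) (hs : Function.Surjective s)
    (h : ∀ k, t (v k) = w (s k)) :
    (∀ p, ((LinearMap.range v).mkQ.prod t) p = 0 ↔ ∃ k, s k = 0 ∧ v k = p) ∧
    ∃ b : ((P ⧸ LinearMap.range v) × Q) →ₗ[R] (Q ⧸ LinearMap.range w),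
      Function.Surjective b ∧
      LinearMap.ker b = LinearMap.range ((LinearMap.range v).mkQ.prod t) := by
  constructor
  · intro p
    constructor
    · intro hp
      have h1 : (LinearMap.range v).mkQ p = 0 := congrArg Prod.fst hp
      have h2 : t p = 0 := congrArg Prod.snd hp
      obtain ⟨k, rfl⟩ : p ∈ LinearMap.range v := by simpa using h1
      exact ⟨k, hw (by rw [← h, h2, map_zero]), rfl⟩
    · rintro ⟨k, hk, rfl⟩
      change ((LinearMap.range v).mkQ (v k), t (v k)) = 0
      rw [h, hk]
      simp
  · have hle : LinearMap.range v ≤ LinearMap.ker ((LinearMap.range w).mkQ.comp t) := by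
      rintro _ ⟨k, rfl⟩
      simp [h]
    refine ⟨(LinearMap.range w).mkQ.comp (LinearMap.snd R _ _) -
      ((LinearMap.range v).liftQ _ hle).comp (LinearMap.fst R _ _), ?_, ?_⟩
    · intro y
      obtain ⟨y, rfl⟩ := Submodule.mkQ_surjective _ y
      exact ⟨(0, y), by simp⟩
    · ext ⟨c, y⟩
      obtain ⟨p, rfl⟩ := Submodule.mkQ_surjective _ c
      constructor
      · intro hy
        have h1 : (LinearMap.range w).mkQ (y - t p) = 0 := by simpa using hy
        obtain ⟨m, hm⟩ : y - t p ∈ LinearMap.range w :=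
          (Submodule.Quotient.mk_eq_zero _).mp h1
        obtain ⟨k, rfl⟩ := hs m
        refine ⟨p + v k, Prod.ext ?_ ?_⟩
        · simp
        · simp [h, hm]
      · rintro ⟨p', hp'⟩
        have h1 : (LinearMap.range v).mkQ p' = (LinearMap.range v).mkQ p := congrArg Prod.fst hp'
        have h2 : t p' = y := congrArg Prod.snd hp'
        rw [← h1, ← h2]
        simp

lemma exists_approx [IsNoetherianRing R] (M : ModuleCat.{0} R) [Module.Finite R M] :
    ∃ (P : ModuleCat.{0} R) (f : M →ₗ[R] P), IsLeftApprox R f := by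
  have : Module.Finite R (Module.Dual R M) := by
    obtain ⟨k, q, hq⟩ := Module.Finite.exists_fin' R M
    exact Module.Finite.of_injective q.dualMap (LinearMap.dualMap_injective_of_surjective hq)
  obtain ⟨n, a, ha⟩ := Submodule.fg_iff_exists_fin_generating_family.mp this.1
  refine ⟨ModuleCat.of R (Fin n → R), LinearMap.pi a, ⟨inferInstanceAs (Module.Finite R (Fin n → R)),
    inferInstanceAs (Module.Projective R (Fin n → R))⟩, fun Q hQ g => ?_⟩
  obtain ⟨_, _⟩ := hQ
  obtain ⟨m, r, s, -, -, hrs⟩ := Module.Finite.exists_comp_eq_id_of_projective R Q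
  have key : ∀ φ : Module.Dual R M, ∃ c : (Fin n → R) →ₗ[R] R, c.comp (LinearMap.pi a) = φ := by
    intro φ
    have hφ : φ ∈ Submodule.span R (Set.range a) := by rw [ha]; trivial
    obtain ⟨c, hc⟩ := (Submodule.mem_span_range_iff_exists_fun R).mp hφ
    refine ⟨∑ i, c i • LinearMap.proj i, ?_⟩
    rw [← hc]
    ext x
    simp
  choose c hc using fun j : Fin m => key ((LinearMap.proj j).comp (s.comp g))
  refine ⟨r.comp (LinearMap.pi c), ?_⟩
  ext x
  have : LinearMap.pi c (LinearMap.pi a x) = s (g x) := by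
    ext j
    exact LinearMap.congr_fun (hc j) x
  change r (LinearMap.pi c (LinearMap.pi a x)) = g x
  rw [this]
  exact LinearMap.congr_fun hrs (g x)

section main

variable [IsNoetherianRing R] (X : ModuleCat.{0} R → Prop)
    (hfg : ∀ M, X M → Module.Finite R M)
    (h1 : ∀ M, X M → ∃ (P : ModuleCat.{0} R) (f : M →ₗ[R] P),
        FGProj R P ∧ Function.Injective f)
    (h2 : ∀ M, X M → ∀ N, IsCosyzygy R N M → X N)
    (h3 : ∀ (L M N : ModuleCat.{0} R) (f : L →ₗ[R] M) (g : M →ₗ[R] N),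
        SES R f g → X M → X N → X L)
    (h4 : ∀ M, X M → FiniteProjDim R M → Module.Projective R M)

include h2 h3 in
lemma X_proj (M : ModuleCat.{0} R) (hM : X M) (P : ModuleCat.{0} R) (hP : FGProj R P) : X P := by
  have h0 : X (ModuleCat.of R PUnit) := by
    refine h3 (ModuleCat.of R PUnit) M M (0 : PUnit →ₗ[R] M) LinearMap.id ⟨?_, ?_, ?_⟩ hM hM
    · intro x y _
      rfl
    · exact Function.surjective_id
    · rw [LinearMap.range_zero]
      exact LinearMap.ker_id
  refine h2 _ h0 P (isCosyzygy_of (P := P) (0 : PUnit →ₗ[R] P) LinearMap.id ⟨hP, ?_⟩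
    Function.surjective_id ?_)
  · intro Q hQ g
    refine ⟨0, ?_⟩
    ext x
    have : x = 0 := rfl
    rw [this, map_zero, map_zero]
  · rw [LinearMap.range_zero]
    exact LinearMap.ker_id

include hfg h1 h2 in
lemma X_approx (M : ModuleCat.{0} R) (hM : X M) : ∃ (P : ModuleCat.{0} R) (f : M →ₗ[R] P),
    IsLeftApprox R f ∧ Function.Injective f ∧ X (ModuleCat.of R (P ⧸ LinearMap.range f)) := by
  have := hfg M hM
  obtain ⟨P, f, hf⟩ := exists_approx M
  refine ⟨P, f, hf, ?_, h2 M hM _ ⟨P, f, hf, ⟨LinearEquiv.refl R _⟩⟩⟩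
  obtain ⟨Q, g, hQ, hg⟩ := h1 M hM
  obtain ⟨h, rfl⟩ := hf.2 Q hQ g
  exact Function.Injective.of_comp hg

include hfg h1 h2 h3 h4 in
/-- extensions of an object of `X` by a projective split if the middle term is in `X` -/
lemma splits (P E M : ModuleCat.{0} R) (hP : FGProj R P) (hE : X E) (hM : X M)
    (j : P →ₗ[R] E) (s : E →ₗ[R] M) (hs : SES R j s) : ∃ r : E →ₗ[R] P, r.comp j = .id := by
  obtain ⟨Q, v, hv, hvi, -⟩ := X_approx X hfg h1 h2 E hE
  obtain ⟨Q', w, hw, hwi, hM'⟩ := X_approx X hfg h1 h2 M hM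
  obtain ⟨t, ht⟩ := hv.2 Q' hw.1 (w.comp s)
  have htv : ∀ k, t (v k) = w (s k) := fun k => LinearMap.congr_fun ht k
  obtain ⟨ha, b, hb, hker⟩ := diagram v w s t hwi hs.2.1 htv
  have hD : X (ModuleCat.of R ((Q ⧸ LinearMap.range v) × Q')) :=
    h2 E hE _ (cosyz_prod v hv Q' hw.1)
  set a := (LinearMap.range v).mkQ.prod t with ha_def
  have hka : LinearMap.ker a = LinearMap.range (v.comp j) := by
    ext q
    rw [LinearMap.mem_ker, ha]
    constructor
    · rintro ⟨k, hk, rfl⟩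
      have : k ∈ LinearMap.range j := by rw [← hs.2.2]; exact hk
      obtain ⟨p, rfl⟩ := this
      exact ⟨p, rfl⟩
    · rintro ⟨p, rfl⟩
      refine ⟨j p, ?_, rfl⟩
      have : j p ∈ LinearMap.ker s := by rw [hs.2.2]; exact ⟨p, rfl⟩
      exact this
  let W : ModuleCat.{0} R := ModuleCat.of R (Q ⧸ LinearMap.ker a)
  have hW : X W := by
    refine h3 W (ModuleCat.of R ((Q ⧸ LinearMap.range v) × Q'))
      (ModuleCat.of R (Q' ⧸ LinearMap.range w)) ((LinearMap.ker a).liftQ a le_rfl) b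
      ⟨?_, hb, ?_⟩ hD hM'
    · rw [← LinearMap.ker_eq_bot]
      exact Submodule.ker_liftQ_eq_bot _ _ _ le_rfl
    · rw [Submodule.range_liftQ]
      exact hker
  have hinj : Function.Injective (v.comp j) := hvi.comp hs.1
  have hWp : Module.Projective R W := by
    refine h4 W hW ⟨1, P, ⟨W, ⟨LinearEquiv.refl R _⟩, Q, (LinearMap.ker a).mkQ, hv.1,
      Submodule.mkQ_surjective _, ?_⟩, hP⟩
    refine ⟨(LinearEquiv.ofInjective _ hinj).trans (LinearEquiv.ofEq _ _ ?_)⟩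
    rw [Submodule.ker_mkQ, hka]
  obtain ⟨σ, hσ⟩ := Module.projective_lifting_property (P := W) (LinearMap.ker a).mkQ .id
    (Submodule.mkQ_surjective _)
  have hcod : ∀ q : Q, q - σ ((LinearMap.ker a).mkQ q) ∈ LinearMap.range (v.comp j) := by
    intro q
    rw [← hka]
    refine (Submodule.Quotient.mk_eq_zero (LinearMap.ker a)).mp ?_
    change (LinearMap.ker a).mkQ (q - σ ((LinearMap.ker a).mkQ q)) = 0
    rw [map_sub, sub_eq_zero]
    exact (LinearMap.congr_fun hσ ((LinearMap.ker a).mkQ q)).symm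
  let ρ : Q →ₗ[R] P := (LinearEquiv.ofInjective _ hinj).symm.toLinearMap.comp
    (LinearMap.codRestrict _ (LinearMap.id - σ.comp (LinearMap.ker a).mkQ) hcod)
  refine ⟨ρ.comp v, ?_⟩
  ext p
  change (LinearEquiv.ofInjective _ hinj).symm _ = p
  rw [LinearEquiv.symm_apply_eq]
  apply Subtype.ext
  have h0 : (LinearMap.ker a).mkQ (v (j p)) = 0 := by
    rw [← LinearMap.mem_ker, Submodule.ker_mkQ, hka]
    exact ⟨p, rfl⟩
  change v (j p) - σ ((LinearMap.ker a).mkQ (v (j p))) = v (j p)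
  rw [h0, map_zero, sub_zero]

include hfg h1 h2 h3 h4 in
lemma X_step (M : ModuleCat.{0} R) (hM : X M) :
    ∃ (K F : ModuleCat.{0} R) (i : K →ₗ[R] F) (p : F →ₗ[R] M), X K ∧ Module.Projective R F ∧
      SES R i p ∧ ∀ φ : K →ₗ[R] R, ∃ ψ : F →ₗ[R] R, ψ.comp i = φ := by
  have := hfg M hM
  obtain ⟨n, p, hp⟩ := Module.Finite.exists_fin' R M
  let F : ModuleCat.{0} R := ModuleCat.of R (Fin n → R)
  have hF : FGProj R F := ⟨inferInstanceAs (Module.Finite R (Fin n → R)),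
    inferInstanceAs (Module.Projective R (Fin n → R))⟩
  let K : ModuleCat.{0} R := ModuleCat.of R (LinearMap.ker p)
  let i : K →ₗ[R] F := (LinearMap.ker p).subtype
  have hi : Function.Injective i := Subtype.val_injective
  have hses : SES R (M := F) i p := ⟨hi, hp, (Submodule.range_subtype _).symm⟩
  have hK : X K := h3 K F M i p hses (X_proj X h2 h3 M hM F hF) hM
  refine ⟨K, F, i, p, hK, hF.2, hses, fun φ => ?_⟩
  obtain ⟨P, u, hu, hui, -⟩ := X_approx X hfg h1 h2 K hK
  obtain ⟨t, ht⟩ := hu.2 F hF i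
  have htv : ∀ k, t (u k) = i (LinearMap.id (R := R) k) := fun k => LinearMap.congr_fun ht k
  obtain ⟨ha, b, hb, hker⟩ := diagram u i .id t hi Function.surjective_id htv
  have hE := h2 K hK _ (cosyz_prod u hu F hF)
  set a := (LinearMap.range u).mkQ.prod t with ha_def
  have hai : Function.Injective a := by
    rw [← LinearMap.ker_eq_bot, LinearMap.ker_eq_bot']
    intro q hq
    obtain ⟨k, hk, rfl⟩ := (ha q).mp hq
    have : k = 0 := hk
    rw [this, map_zero]
  let e : (F ⧸ LinearMap.range i) ≃ₗ[R] M := (Submodule.quotEquivOfEq _ _ hses.2.2.symm).trans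
    (LinearMap.quotKerEquivOfSurjective p hp)
  obtain ⟨r, hr⟩ := splits X hfg h1 h2 h3 h4 P
    (ModuleCat.of R ((P ⧸ LinearMap.range u) × F)) M hu.1 hE hM a (e.toLinearMap.comp b)
    ⟨hai, e.surjective.comp hb, by
      rw [LinearMap.ker_comp, LinearEquiv.ker, ← hker]; rfl⟩
  obtain ⟨φ', hφ'⟩ := hu.2 (ModuleCat.of R R) ⟨inferInstanceAs (Module.Finite R R),
    inferInstanceAs (Module.Projective R R)⟩ φ
  refine ⟨φ'.comp (r.comp (LinearMap.inr R (P ⧸ LinearMap.range u) F)), ?_⟩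
  ext k
  have h5 : a (u k) = (0, i k) := by
    refine Prod.ext ?_ (htv k)
    change (LinearMap.range u).mkQ (u k) = 0
    simp
  change φ' (r (0, i k)) = φ k
  rw [← h5, ← hφ']
  exact congrArg φ' (LinearMap.congr_fun hr (u k))

include hfg h1 h2 in
lemma eval_injective (M : ModuleCat.{0} R) (hM : X M) :
    Function.Injective (Module.Dual.eval R M) := by
  obtain ⟨P, f, hf, hfi, -⟩ := X_approx X hfg h1 h2 M hM
  obtain ⟨_, _⟩ := hf.1
  intro x y hxy
  apply hfi
  apply (Module.bijective_dual_eval R P).1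
  ext α
  exact LinearMap.congr_fun hxy (α.comp f)

include hfg h1 h2 in
lemma eval_bijective (M : ModuleCat.{0} R) (hM : X M) :
    Function.Bijective (Module.Dual.eval R M) := by
  refine ⟨eval_injective X hfg h1 h2 M hM, fun θ => ?_⟩
  obtain ⟨P, f, hf, hfi, hC⟩ := X_approx X hfg h1 h2 M hM
  obtain ⟨_, _⟩ := hf.1
  obtain ⟨p, hp⟩ := (Module.bijective_dual_eval R P).2 (θ.comp f.dualMap)
  have hp' : ∀ α : P →ₗ[R] R, α p = θ (α.comp f) := fun α => LinearMap.congr_fun hp α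
  have h0 : (LinearMap.range f).mkQ p = 0 := by
    apply eval_injective X hfg h1 h2 _ hC
    rw [map_zero]
    ext γ
    change γ ((LinearMap.range f).mkQ p) = 0
    have h5 := hp' (LinearMap.comp γ (LinearMap.range f).mkQ)
    have h6 : (LinearMap.comp γ (LinearMap.range f).mkQ).comp f = 0 := by
      rw [LinearMap.comp_assoc, LinearMap.range_mkQ_comp, LinearMap.comp_zero]
    rw [h6, map_zero] at h5
    exact h5
  obtain ⟨m, rfl⟩ : p ∈ LinearMap.range f := by simpa using h0
  refine ⟨m, ?_⟩
  ext γ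
  obtain ⟨α, hα⟩ := hf.2 (ModuleCat.of R R) ⟨inferInstanceAs (Module.Finite R R),
    inferInstanceAs (Module.Projective R R)⟩ γ
  have := hp' α
  rw [hα] at this
  rw [← this, ← hα]
  rfl

include hfg h1 h2 in
lemma dual_step (N : ModuleCat.{0} R)
    (hN : ∃ M, X M ∧ N = ModuleCat.of R (Module.Dual R M)) :
    ∃ (K F : ModuleCat.{0} R) (i : K →ₗ[R] F) (p : F →ₗ[R] N),
      (∃ M, X M ∧ K = ModuleCat.of R (Module.Dual R M)) ∧ Module.Projective R F ∧
      SES R i p ∧ ∀ φ : K →ₗ[R] R, ∃ ψ : F →ₗ[R] R, ψ.comp i = φ := by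
  obtain ⟨M, hM, rfl⟩ := hN
  obtain ⟨P, f, hf, hfi, hC⟩ := X_approx X hfg h1 h2 M hM
  obtain ⟨_, _⟩ := hf.1
  refine ⟨ModuleCat.of R (Module.Dual R (P ⧸ LinearMap.range f)),
    ModuleCat.of R (Module.Dual R P), (LinearMap.range f).mkQ.dualMap, f.dualMap,
    ⟨_, hC, rfl⟩, inferInstanceAs (Module.Projective R (Module.Dual R P)), ⟨?_, ?_, ?_⟩, ?_⟩
  · exact LinearMap.dualMap_injective_of_surjective (Submodule.mkQ_surjective _)
  · intro γ
    exact hf.2 (ModuleCat.of R R) ⟨inferInstanceAs (Module.Finite R R),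
      inferInstanceAs (Module.Projective R R)⟩ γ
  · ext (α : P →ₗ[R] R)
    constructor
    · intro h
      have h : α.comp f = 0 := h
      have hle : LinearMap.range f ≤ LinearMap.ker α := by
        rintro _ ⟨m, rfl⟩
        exact LinearMap.congr_fun h m
      exact ⟨(LinearMap.range f).liftQ α hle, Submodule.liftQ_mkQ _ _ hle⟩
    · rintro ⟨γ, rfl⟩
      change (LinearMap.comp γ (LinearMap.range f).mkQ).comp f = 0
      rw [LinearMap.comp_assoc, LinearMap.range_mkQ_comp, LinearMap.comp_zero]
  · intro φ
    obtain ⟨c, hc⟩ := (eval_bijective X hfg h1 h2 _ hC).2 φ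
    obtain ⟨p, rfl⟩ := Submodule.mkQ_surjective _ c
    exact ⟨Module.Dual.eval R P p, hc⟩

end main

section ext

variable {S F : ℕ → ModuleCat.{0} R}
  (i : ∀ n, S (n + 1) →ₗ[R] F n) (p : ∀ n, F n →ₗ[R] S n)
  (hF : ∀ n, Module.Projective R (F n))
  (hses : ∀ n, SES R (i n) (p n))

include hses in
lemma p_i (n : ℕ) (x : S (n + 1)) : p n (i n x) = 0 := by
  have : i n x ∈ LinearMap.ker (p n) := by
    rw [(hses n).2.2]
    exact ⟨x, rfl⟩
  exact this

/-- the spliced complex -/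
def cplx : ChainComplex (ModuleCat.{0} R) ℕ :=
  ChainComplex.of F (fun n => ModuleCat.ofHom ((i n).comp (p (n + 1)))) (fun n => by
    ext x
    change i n (p (n + 1) (i (n + 1) (p (n + 2) x))) = 0
    rw [p_i i p hses, map_zero])

lemma cplx_d (n : ℕ) : (cplx i p hses).d (n + 1) n = ModuleCat.ofHom ((i n).comp (p (n + 1))) := by
  have h := ChainComplex.of_d F (fun n => ModuleCat.ofHom ((i n).comp (p (n + 1)))) n
  exact h

lemma cplx_exactAt (n : ℕ) : (cplx i p hses).ExactAt (n + 1) := by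
  rw [HomologicalComplex.exactAt_iff' _ (n + 1 + 1) (n + 1) n (by simp) (by simp)]
  rw [ShortComplex.moduleCat_exact_iff]
  intro (x : F (n + 1)) hx
  change ((cplx i p hses).d (n + 1) n).hom x = 0 at hx
  rw [cplx_d] at hx
  have h0 : p (n + 1) x = 0 := (hses n).1 (by rw [map_zero]; exact hx)
  have h1 : x ∈ LinearMap.range (i (n + 1)) := by
    rw [← (hses (n + 1)).2.2]; exact h0
  obtain ⟨y, rfl⟩ := h1
  obtain ⟨z, rfl⟩ := (hses (n + 2)).2.1 y
  refine ⟨z, ?_⟩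
  change ((cplx i p hses).d (n + 1 + 1) (n + 1)).hom z = _
  rw [cplx_d]
  rfl

/-- the augmentation -/
def aug : (cplx i p hses).X 0 ⟶ S 0 := ModuleCat.ofHom (p 0)

lemma aug_zero : (cplx i p hses).d 1 0 ≫ aug i p hses = 0 := by
  rw [cplx_d]
  ext x
  exact p_i i p hses 0 _

/-- the spliced projective resolution -/
def res : ProjectiveResolution (S 0) where
  complex := cplx i p hses
  projective n := (IsProjective.iff_projective (R := R) (F n)).mp (hF n)
  π := (ChainComplex.toSingle₀Equiv _ _).symm ⟨aug i p hses, aug_zero i p hses⟩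
  quasiIso := ⟨fun n => by
    cases n
    · rw [ChainComplex.quasiIsoAt₀_iff, ShortComplex.quasiIso_iff_of_zeros']
      · refine ⟨?_, ?_⟩
        · rw [ShortComplex.moduleCat_exact_iff]
          intro (x : F 0) hx
          have hx : p 0 x = 0 := by
            refine Eq.trans ?_ hx
            exact (LinearMap.congr_fun (congrArg ModuleCat.Hom.hom
              (ChainComplex.toSingle₀Equiv_symm_apply_f_zero (aug i p hses) (aug_zero i p hses))) x).symm
          have h1 : x ∈ LinearMap.range (i 0) := by
            rw [← (hses 0).2.2]; exact hx
          obtain ⟨y, rfl⟩ := h1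
          obtain ⟨z, rfl⟩ := (hses 1).2.1 y
          refine ⟨z, ?_⟩
          change ((cplx i p hses).d 1 0).hom z = _
          rw [cplx_d]
          rfl
        · refine (ModuleCat.epi_iff_surjective _).mpr ?_
          intro y
          obtain ⟨x, hx⟩ := (hses 0).2.1 y
          refine ⟨x, Eq.trans ?_ hx⟩
          exact (LinearMap.congr_fun (congrArg ModuleCat.Hom.hom
              (ChainComplex.toSingle₀Equiv_symm_apply_f_zero (aug i p hses) (aug_zero i p hses))) x)
      all_goals rfl
    · rw [quasiIsoAt_iff_exactAt']
      · apply cplx_exactAt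
      · exact ChainComplex.exactAt_succ_single_obj _ _⟩

include hF hses in
lemma ext_vanish_aux
    (hext : ∀ n, ∀ φ : S (n + 1) →ₗ[R] R, ∃ ψ : F n →ₗ[R] R, ψ.comp (i n) = φ) (n : ℕ) :
    ExtVanish R (S 0) (ModuleCat.of R R) (n + 1) := by
  unfold ExtVanish
  rw [← ModuleCat.isZero_iff_subsingleton]
  refine Limits.IsZero.of_iso ?_ ((res i p hF hses).isoExt (R := R) (n + 1) (ModuleCat.of R R))
  rw [← HomologicalComplex.exactAt_iff_isZero_homology,
    HomologicalComplex.exactAt_iff' _ n (n + 1) (n + 1 + 1) (by simp) (by simp)]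
  rw [ShortComplex.moduleCat_exact_iff]
  intro (φ : F (n + 1) ⟶ ModuleCat.of R R) hφ
  have hφ : (cplx i p hses).d (n + 1 + 1) (n + 1) ≫ φ = 0 := hφ
  rw [cplx_d] at hφ
  have hφ' : ∀ x, φ.hom (i (n + 1) x) = 0 := by
    intro x
    obtain ⟨z, rfl⟩ := (hses (n + 2)).2.1 x
    exact LinearMap.congr_fun (congrArg ModuleCat.Hom.hom hφ) z
  have hle : LinearMap.ker (p (n + 1)) ≤ LinearMap.ker φ.hom := by
    rw [(hses (n + 1)).2.2]
    rintro _ ⟨x, rfl⟩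
    exact hφ' x
  obtain ⟨ψ, hψ⟩ := hext n (((LinearMap.ker (p (n + 1))).liftQ φ.hom hle).comp
    ((p (n + 1)).quotKerEquivOfSurjective (hses (n + 1)).2.1).symm.toLinearMap)
  refine ⟨(ModuleCat.ofHom ψ : F n ⟶ ModuleCat.of R R), ?_⟩
  change (cplx i p hses).d (n + 1) n ≫ ModuleCat.ofHom ψ = φ
  rw [cplx_d]
  ext (x : F (n + 1))
  change ψ (i n (p (n + 1) x)) = φ.hom x
  have h5 := LinearMap.congr_fun hψ (p (n + 1) x)
  refine h5.trans ?_
  have h6 : ((p (n + 1)).quotKerEquivOfSurjective (hses (n + 1)).2.1).symm (p (n + 1) x) =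
      Submodule.Quotient.mk x := by
    rw [LinearEquiv.symm_apply_eq]
    rfl
  change ((LinearMap.ker (p (n + 1))).liftQ φ.hom hle)
    (((p (n + 1)).quotKerEquivOfSurjective (hses (n + 1)).2.1).symm (p (n + 1) x)) = _
  rw [h6]
  rfl

end ext

lemma ext_vanish (Y : ModuleCat.{0} R → Prop)
    (hY : ∀ M, Y M → ∃ (K F : ModuleCat.{0} R) (i : K →ₗ[R] F) (p : F →ₗ[R] M),
      Y K ∧ Module.Projective R F ∧
      SES R i p ∧ ∀ φ : K →ₗ[R] R, ∃ ψ : F →ₗ[R] R, ψ.comp i = φ)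
    (M : ModuleCat.{0} R) (hM : Y M) (n : ℕ) (hn : 0 < n) :
    ExtVanish R M (ModuleCat.of R R) n := by
  obtain ⟨n, rfl⟩ := Nat.exists_eq_succ_of_ne_zero hn.ne'
  choose K F i p hK hF hses hext using fun M : {M // Y M} => hY M.1 M.2
  let S : ℕ → {M // Y M} := fun n => Nat.rec ⟨M, hM⟩ (fun _ s => ⟨K s, hK s⟩) n
  exact ext_vanish_aux (S := fun n => (S n).1) (F := fun n => F (S n)) (fun n => i (S n))
    (fun n => p (S n)) (fun n => hF _) (fun n => hses (S n)) (fun n => hext (S n)) n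

end Aux

open Paper


/-- a subcategory of first syzygy modules, closed under cosyzygies and
kernels of epimorphisms, whose only modules of finite projective dimension are the
projectives, consists of totally reflexive modules. -/
theorem stmt3 (R : Type) [CommRing R] [IsNoetherianRing R]
    (X : ModuleCat.{0} R → Prop)
    (hfg : ∀ M, X M → Module.Finite R M)
    (h1 : ∀ M, X M → ∃ (P : ModuleCat.{0} R) (f : M →ₗ[R] P),
        FGProj R P ∧ Function.Injective f)
    (h2 : ∀ M, X M → ∀ N, IsCosyzygy R N M → X N)
    (h3 : ∀ (L M N : ModuleCat.{0} R) (f : L →ₗ[R] M) (g : M →ₗ[R] N),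
        SES R f g → X M → X N → X L)
    (h4 : ∀ M, X M → FiniteProjDim R M → Module.Projective R M) :
    ∀ M, X M → TotallyReflexive R M := by
  intro M hM
  refine ⟨Aux.eval_bijective X hfg h1 h2 M hM, fun i hi => ⟨?_, ?_⟩⟩
  · exact Aux.ext_vanish X (Aux.X_step X hfg h1 h2 h3 h4) M hM i hi
  · exact Aux.ext_vanish _ (Aux.dual_step X hfg h1 h2) _ ⟨M, hM, rfl⟩ i hi
end
end

section
/- Let X be a resolving subcategory of finitely generated R-modules with ΩX = X (every module of X is a syzygy of a module of X). Then every module in X is totally reflexive. -/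
open CategoryTheory

noncomputable section

open Paper

open CategoryTheory

namespace Paper

section ExtPart

variable {R : Type} [CommRing R]

/-- vanishing of the derived-category Ext implies vanishing of the classical one -/
lemma extVanish_of_abelianExt (M N : ModuleCat.{0} R) (n : ℕ)
    (h : ∀ x : Abelian.Ext M N (n + 1), x = 0) : ExtVanish R M N (n + 1) := by
  let P := projectiveResolution M
  have hz : Limits.IsZero (((Ext R (ModuleCat.{0} R) (n + 1)).obj (Opposite.op M)).obj N) := by
    refine Limits.IsZero.of_iso ?_ (P.isoExt (n + 1) N)
    rw [← HomologicalComplex.exactAt_iff_isZero_homology,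
      HomologicalComplex.exactAt_iff' _ n (n + 1) (n + 2) (by simp) (by simp),
      ShortComplex.moduleCat_exact_iff]
    intro (x : P.complex.X (n + 1) ⟶ N) hx
    have hx' : P.complex.d (n + 2) (n + 1) ≫ x = 0 := hx
    obtain ⟨g, hg⟩ := (P.extMk_eq_zero_iff x (n + 2) rfl hx' n rfl).1 (h _)
    exact ⟨g, hg⟩
  exact ModuleCat.subsingleton_of_isZero hz

/-- a class of modules closed under syzygies with the extension property has vanishing Ext -/
lemma ext_zero_of_class (Y : ModuleCat.{0} R → Prop) (T : ModuleCat.{0} R)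
    (hY : ∀ M, Y M → ∃ (K Q : ModuleCat.{0} R) (i : K →ₗ[R] Q) (p : Q →ₗ[R] M),
      Y K ∧ Module.Projective R Q ∧ SES R i p ∧
        ∀ g : K →ₗ[R] T, ∃ h : Q →ₗ[R] T, h.comp i = g)
    (n : ℕ) : ∀ M, Y M → ∀ x : Abelian.Ext M T (n + 1), x = 0 := by
  induction n with
  | zero =>
    intro M hM x
    obtain ⟨K, Q, i, p, -, hQ, ⟨hi, hp, hk⟩, hext⟩ := hY M hM
    have hex : Function.Exact i p := LinearMap.exact_iff.2 hk
    let S : ShortComplex (ModuleCat.{0} R) :=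
      ShortComplex.mk (ModuleCat.ofHom i) (ModuleCat.ofHom p)
        (by ext y; exact hex.apply_apply_eq_zero y)
    have hS : S.ShortExact := ModuleCat.shortComplex_shortExact S hex hi hp
    have : Projective S.X₂ := (IsProjective.iff_projective (R := R) Q).1 hQ
    obtain ⟨x₁, rfl⟩ := Abelian.Ext.contravariant_sequence_exact₃ hS T x
      (Abelian.Ext.eq_zero_of_projective _) (n₀ := 0) rfl
    obtain ⟨g, rfl⟩ := (Abelian.Ext.mk₀_bijective _ _).2 x₁
    obtain ⟨h, hh⟩ := hext g.hom
    have : g = S.f ≫ ModuleCat.ofHom h := by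
      ext y; exact (LinearMap.congr_fun hh y).symm
    rw [this, ← Abelian.Ext.mk₀_comp_mk₀]
    exact hS.extClass_comp_assoc _
  | succ n ih =>
    intro M hM x
    obtain ⟨K, Q, i, p, hK, hQ, ⟨hi, hp, hk⟩, hext⟩ := hY M hM
    have hex : Function.Exact i p := LinearMap.exact_iff.2 hk
    let S : ShortComplex (ModuleCat.{0} R) :=
      ShortComplex.mk (ModuleCat.ofHom i) (ModuleCat.ofHom p)
        (by ext y; exact hex.apply_apply_eq_zero y)
    have hS : S.ShortExact := ModuleCat.shortComplex_shortExact S hex hi hp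
    have : Projective S.X₂ := (IsProjective.iff_projective (R := R) Q).1 hQ
    obtain ⟨x₁, rfl⟩ := Abelian.Ext.contravariant_sequence_exact₃ hS T x
      (Abelian.Ext.eq_zero_of_projective _) (n₀ := n + 1) (by omega)
    rw [ih K hK x₁, Abelian.Ext.comp_zero]

end ExtPart

section Key

variable {R : Type} [CommRing R]

/-- `Tor_1(N, R/J) = 0` for all `N` in `X` -/
def GoodIdeal (X : ModuleCat.{0} R → Prop) (J : Ideal R) : Prop :=
  ∀ (N P : ModuleCat.{0} R) (f : P →ₗ[R] N), X N → FGProj R P → Function.Surjective f →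
    ∀ z, f z = 0 → z ∈ J • (⊤ : Submodule R P) → z ∈ J • LinearMap.ker f

lemma exists_cosyz {X : ModuleCat.{0} R → Prop}
    (h2 : ∀ M, X M → ∃ N, X N ∧ IsSyzygy R M N) (M : ModuleCat.{0} R) (hM : X M) :
    ∃ (N P : ModuleCat.{0} R) (i : M →ₗ[R] P) (f : P →ₗ[R] N), X N ∧ FGProj R P ∧ SES R i f := by
  obtain ⟨N, hN, P, f, hP, hf, ⟨e⟩⟩ := h2 M hM
  refine ⟨N, P, (LinearMap.ker f).subtype ∘ₗ e.toLinearMap, f, hN, hP, ?_, hf, ?_⟩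
  · exact (Submodule.injective_subtype _).comp e.injective
  · rw [LinearMap.range_comp, LinearEquiv.range, Submodule.map_top, Submodule.range_subtype]

/-- the functionals detect membership in `J • P` -/
lemma mem_smul_top_of_dual {P : Type} [AddCommGroup P] [Module R P] [Module.Finite R P]
    [Module.Projective R P] (J : Ideal R) (y : P)
    (h : ∀ φ : Module.Dual R P, φ y ∈ J) : y ∈ J • (⊤ : Submodule R P) := by
  obtain ⟨n, f, g, -, -, hfg⟩ := Module.Finite.exists_comp_eq_id_of_projective R P
  have : y = ∑ k, (g y k) • f (Pi.single k 1) := by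
    have h0 : f (g y) = y := LinearMap.congr_fun hfg y
    conv_lhs => rw [← h0, pi_eq_sum_univ' (g y)]
    simp [map_sum]
  rw [this]
  refine Submodule.sum_mem _ fun k _ => Submodule.smul_mem_smul ?_ trivial
  exact h ((LinearMap.proj k).comp g)

lemma dual_mem_of_mem_smul_top {P : Type} [AddCommGroup P] [Module R P] (J : Ideal R) (y : P)
    (hy : y ∈ J • (⊤ : Submodule R P)) (φ : Module.Dual R P) : φ y ∈ J := by
  have : φ y ∈ Submodule.map φ (J • ⊤) := Submodule.mem_map_of_mem hy
  rw [Submodule.map_smul''] at this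
  exact Ideal.mul_le_right (I := Submodule.map φ ⊤) (by simpa [mul_comm] using this)

lemma goodIdeal_bot (X : ModuleCat.{0} R → Prop) : GoodIdeal X ⊥ := by
  intro N P f _ _ _ z _ hz
  simpa using hz

lemma GoodIdeal.step {X : ModuleCat.{0} R → Prop}
    (h2 : ∀ M, X M → ∃ N, X N ∧ IsSyzygy R M N) {J : Ideal R} (hJ : GoodIdeal X J)
    (x : R) (hx : ∀ r, x * r ∈ J → r ∈ J) : GoodIdeal X (J ⊔ Ideal.span {x}) := by
  intro N P f hN hP hf z hz hzJ
  rw [Submodule.sup_smul] at hzJ ⊢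
  obtain ⟨j, hj, w, hw, rfl⟩ := Submodule.mem_sup.1 hzJ
  rw [Submodule.ideal_span_singleton_smul, Submodule.mem_smul_pointwise_iff_exists] at hw
  obtain ⟨p, -, rfl⟩ := hw
  obtain ⟨N', Q, i, g, hN', hQ, hi, hg, hk⟩ := exists_cosyz h2 N hN
  have hmap : ∀ {n : N}, n ∈ J • (⊤ : Submodule R N) ↔ ∃ j ∈ J • (⊤ : Submodule R P), f j = n := by
    intro n
    rw [← Submodule.mem_map, Submodule.map_smul'', Submodule.map_top, LinearMap.range_eq_top.2 hf]
  -- `x f(p) ∈ J N`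
  have h3 : x • f p ∈ J • (⊤ : Submodule R N) := by
    refine hmap.2 ⟨-j, neg_mem hj, ?_⟩
    rw [map_add, map_smul] at hz
    rw [map_neg]
    exact neg_eq_of_add_eq_zero_right hz
  have h4 : i (f p) ∈ J • (⊤ : Submodule R Q) := by
    have := hQ.1
    have := hQ.2
    refine mem_smul_top_of_dual J _ fun φ => hx _ ?_
    have := dual_mem_of_mem_smul_top J _ h3 (φ.comp i)
    simpa using this
  have h5 : f p ∈ J • (⊤ : Submodule R N) := by
    have := hJ N' Q g hN' hQ hg (i (f p)) (by
      have : i (f p) ∈ LinearMap.ker g := hk ▸ LinearMap.mem_range_self i _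
      exact this) h4
    rw [hk, ← Submodule.map_top, ← Submodule.map_smul''] at this
    obtain ⟨n, hn, hn'⟩ := this
    rwa [← hi hn']
  obtain ⟨j', hj', hj''⟩ := hmap.1 h5
  have hpk : p - j' ∈ LinearMap.ker f := by simp [hj'']
  have : j + x • p = (j + x • j') + x • (p - j') := by rw [smul_sub]; abel
  rw [this] at hz ⊢
  refine Submodule.add_mem_sup ?_ (Submodule.smul_mem_smul (Ideal.mem_span_singleton_self x) hpk)
  refine hJ N P f hN hP hf _ ?_ (add_mem hj (Submodule.smul_mem _ _ hj'))
  rw [map_add, map_smul f x (p - j'), LinearMap.mem_ker.1 hpk, smul_zero, add_zero] at hz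
  exact hz

/-- a map `R → P` with cokernel in `X` splits -/
lemma split_of_coker [IsNoetherianRing R] {X : ModuleCat.{0} R → Prop}
    (h2 : ∀ M, X M → ∃ N, X N ∧ IsSyzygy R M N)
    (P C : ModuleCat.{0} R) (f : R →ₗ[R] P) (g : P →ₗ[R] C) (hC : X C) (hP : FGProj R P)
    (hf : Function.Injective f) (hg : Function.Surjective g)
    (hk : LinearMap.ker g = LinearMap.range f) :
    ∃ φ : P →ₗ[R] R, φ (f 1) = 1 := by
  have := hP.1
  have := hP.2
  let I : Ideal R := LinearMap.range (LinearMap.applyₗ (R := R) (f 1) : Module.Dual R P →ₗ[R] R)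
  have hI : ∀ φ : Module.Dual R P, φ (f 1) ∈ I := fun φ => ⟨φ, rfl⟩
  suffices hT : I = ⊤ by
    have : (1 : R) ∈ I := hT ▸ trivial
    obtain ⟨φ, hφ⟩ := this
    exact ⟨φ, hφ⟩
  by_contra hne
  obtain ⟨J, ⟨hJg, hJI⟩, hmax⟩ := set_has_maximal_iff_noetherian.2 ‹IsNoetherianRing R›
    {J : Ideal R | GoodIdeal X J ∧ J ⊔ I ≠ ⊤} ⟨⊥, goodIdeal_bot X, by simpa using hne⟩
  -- injectivity modulo `J`
  have hinj : ∀ r : R, f r ∈ J • (⊤ : Submodule R P) → r ∈ J := by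
    intro r hr
    have := hJg C P g hC hP hg (f r) (by
      have : f r ∈ LinearMap.ker g := hk ▸ LinearMap.mem_range_self f _
      exact this) hr
    rw [hk, ← Submodule.map_top, ← Submodule.map_smul''] at this
    obtain ⟨n, hn, hn'⟩ := this
    rw [← hf hn']
    simpa using hn
  have hann : ∀ r : R, (∀ a ∈ I, r * a ∈ J) → r ∈ J := by
    intro r hr
    refine hinj r (mem_smul_top_of_dual J _ fun φ => ?_)
    have : f r = r • f 1 := by rw [← map_smul, smul_eq_mul, mul_one]
    rw [this, map_smul]
    exact hr _ (hI φ)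
  have hsub : Subsingleton ((R ⧸ I) →ₗ[R] (R ⧸ J)) := by
    refine subsingleton_of_forall_eq 0 fun h => ?_
    ext
    obtain ⟨r, hr⟩ := Ideal.Quotient.mk_surjective (h (Ideal.Quotient.mk I 1))
    have hrJ : r ∈ J := by
      refine hann r fun a ha => ?_
      rw [← Ideal.Quotient.eq_zero_iff_mem, mul_comm, ← smul_eq_mul, ← Ideal.Quotient.mkₐ_eq_mk R,
        map_smul, Ideal.Quotient.mkₐ_eq_mk, hr, ← map_smul]
      have : a • (Ideal.Quotient.mk I 1) = 0 := by
        rw [← Ideal.Quotient.mkₐ_eq_mk R, ← map_smul, Ideal.Quotient.mkₐ_eq_mk,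
          Ideal.Quotient.eq_zero_iff_mem]
        simpa using ha
      rw [this, map_zero]
    have h0 : h (Ideal.Quotient.mk I 1) = 0 := by
      rw [← hr, Ideal.Quotient.eq_zero_iff_mem]; exact hrJ
    simpa using h0
  obtain ⟨x, hxI, hxreg⟩ := IsSMulRegular.subsingleton_linearMap_iff.1 hsub
  rw [Ideal.annihilator_quotient] at hxI
  have hx : ∀ r, x * r ∈ J → r ∈ J := by
    intro r hr
    rw [← Ideal.Quotient.eq_zero_iff_mem]
    apply hxreg
    change x • _ = x • (0 : R ⧸ J)
    rw [smul_zero, ← Ideal.Quotient.mkₐ_eq_mk R, ← map_smul, Ideal.Quotient.mkₐ_eq_mk,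
      Ideal.Quotient.eq_zero_iff_mem]
    exact hr
  have hle : Ideal.span {x} ≤ I := (Ideal.span_singleton_le_iff_mem _).2 hxI
  have hxJ : x ∈ J := by
    by_contra hxJ
    refine hmax (J ⊔ Ideal.span {x}) ⟨hJg.step h2 x hx, ?_⟩ ?_
    · rw [sup_assoc, sup_eq_right.2 hle]; exact hJI
    · refine lt_of_le_of_ne le_sup_left fun h => hxJ ?_
      rw [h]
      exact Ideal.mem_sup_right (Ideal.mem_span_singleton_self x)
  apply hJI
  rw [Ideal.eq_top_iff_one]
  exact Ideal.mem_sup_left (hx 1 (by simpa using hxJ))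

end Key

end Paper
namespace Paper

section Main

variable {R : Type} [CommRing R]

/-- `Ext^1(M, R) = 0` for `M` in `X`, in terms of extending functionals -/
lemma extend_functional [IsNoetherianRing R] {X : ModuleCat.{0} R → Prop} (hX : Resolving R X)
    (h2 : ∀ M, X M → ∃ N, X N ∧ IsSyzygy R M N)
    (K Q M : ModuleCat.{0} R) (i : K →ₗ[R] Q) (p : Q →ₗ[R] M) (hip : SES R i p) (hM : X M)
    (g : K →ₗ[R] R) : ∃ h : Q →ₗ[R] R, h.comp i = g := by
  obtain ⟨hi, hp, hk⟩ := hip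
  have hpi : ∀ k, p (i k) = 0 := fun k => by
    have : i k ∈ LinearMap.ker p := hk ▸ LinearMap.mem_range_self i k
    exact this
  -- the pushout `E`
  let S : Submodule R (R × Q) := LinearMap.range (LinearMap.prod g (-i))
  let E : ModuleCat.{0} R := ModuleCat.of R ((R × Q) ⧸ S)
  let a : ModuleCat.of R R →ₗ[R] E := S.mkQ.comp (LinearMap.inl R R Q)
  have hSle : S ≤ LinearMap.ker (p.comp (LinearMap.snd R R Q)) := by
    rintro _ ⟨k, rfl⟩
    simp [hpi]
  let b : E →ₗ[R] M := S.liftQ (p.comp (LinearMap.snd R R Q)) hSle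
  have hb_mk : ∀ r q, b (S.mkQ (r, q)) = p q := fun r q => rfl
  have hab : SES R a b := by
    refine ⟨?_, ?_, ?_⟩
    · rw [injective_iff_map_eq_zero]
      intro r hr
      have : ((r, 0) : R × Q) ∈ S := (Submodule.Quotient.mk_eq_zero S).1 hr
      obtain ⟨k, hk'⟩ := this
      rw [Prod.ext_iff] at hk'
      have h0 : k = 0 := hi (by simpa using hk'.2)
      have := hk'.1
      rw [h0] at this
      simpa using this.symm
    · intro m
      obtain ⟨q, rfl⟩ := hp m
      exact ⟨S.mkQ (0, q), rfl⟩
    · ext e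
      constructor
      · intro he
        obtain ⟨⟨r, q⟩, rfl⟩ := S.mkQ_surjective e
        have : q ∈ LinearMap.ker p := he
        rw [hk] at this
        obtain ⟨k, rfl⟩ := this
        refine ⟨r + g k, ?_⟩
        refine (Submodule.Quotient.eq S).2 ⟨k, ?_⟩
        simp
      · rintro ⟨r, rfl⟩
        change p 0 = 0
        simp
  have hXR : X (ModuleCat.of R R) := hX.proj _ ⟨Module.Finite.self R, inferInstance⟩
  have hE : X E := hX.extension _ E M a b hab hXR hM
  obtain ⟨N, P, ι, f, hN, hP, hι, hf, hkf⟩ := exists_cosyz h2 E hE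
  let ρ : ModuleCat.of R R →ₗ[R] P := ι.comp a
  let C : ModuleCat.{0} R := ModuleCat.of R (P ⧸ LinearMap.range ρ)
  have hle : LinearMap.ker b ≤ (LinearMap.range ρ).comap ι := by
    rw [hab.2.2]
    rintro _ ⟨r, rfl⟩
    exact ⟨r, rfl⟩
  let u : M →ₗ[R] C := ((LinearMap.ker b).mapQ (LinearMap.range ρ) ι hle).comp
    (b.quotKerEquivOfSurjective hab.2.1).symm.toLinearMap
  have hu : ∀ e, u (b e) = (LinearMap.range ρ).mkQ (ι e) := by
    intro e
    have : (b.quotKerEquivOfSurjective hab.2.1).symm (b e) = (LinearMap.ker b).mkQ e := by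
      rw [LinearEquiv.symm_apply_eq]; rfl
    simp only [u, LinearMap.comp_apply, LinearEquiv.coe_coe, this]
    rfl
  have hle2 : LinearMap.range ρ ≤ LinearMap.ker f := by
    rw [hkf]
    rintro _ ⟨r, rfl⟩
    exact ⟨a r, rfl⟩
  let v : C →ₗ[R] N := (LinearMap.range ρ).liftQ f hle2
  have hv : ∀ y, v ((LinearMap.range ρ).mkQ y) = f y := fun y => rfl
  have huv : SES R u v := by
    refine ⟨?_, ?_, ?_⟩
    · rw [injective_iff_map_eq_zero]
      intro m hm
      obtain ⟨e, rfl⟩ := hab.2.1 m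
      rw [hu] at hm
      obtain ⟨r, hr⟩ := (Submodule.Quotient.mk_eq_zero _).1 hm
      have : a r = e := hι hr
      rw [← this]
      have : a r ∈ LinearMap.ker b := hab.2.2 ▸ LinearMap.mem_range_self a r
      exact this
    · intro n
      obtain ⟨y, rfl⟩ := hf n
      exact ⟨(LinearMap.range ρ).mkQ y, rfl⟩
    · ext c
      constructor
      · intro hc
        obtain ⟨y, rfl⟩ := (LinearMap.range ρ).mkQ_surjective c
        have : y ∈ LinearMap.ker f := hc
        rw [hkf] at this
        obtain ⟨e, rfl⟩ := this
        exact ⟨b e, hu e⟩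
      · rintro ⟨m, rfl⟩
        obtain ⟨e, rfl⟩ := hab.2.1 m
        rw [hu, LinearMap.mem_ker, hv]
        have : ι e ∈ LinearMap.ker f := hkf ▸ LinearMap.mem_range_self ι e
        exact this
  have hC : X C := hX.extension M C N u v huv hM hN
  obtain ⟨φ, hφ⟩ := split_of_coker h2 P C ρ (LinearMap.range ρ).mkQ hC hP (hι.comp hab.1)
    (Submodule.mkQ_surjective _) (Submodule.ker_mkQ _)
  have hφ' : ∀ r : R, φ (ρ r) = r := by
    intro r
    have : ρ r = r • ρ (1 : R) := by
      rw [← map_smul]; congr 1; exact (mul_one r).symm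
    rw [this, map_smul, hφ]; simp
  refine ⟨φ.comp (ι.comp (S.mkQ.comp (LinearMap.inr R R Q))), ?_⟩
  ext k
  have : S.mkQ (0, i k) = a (g k) := by
    refine (Submodule.Quotient.eq S).2 ⟨-k, ?_⟩
    simp
  change φ (ι (S.mkQ (0, i k))) = g k
  rw [this]
  exact hφ' _

lemma eval_injective {X : ModuleCat.{0} R → Prop}
    (h2 : ∀ M, X M → ∃ N, X N ∧ IsSyzygy R M N) (M : ModuleCat.{0} R) (hM : X M) :
    Function.Injective (Module.Dual.eval R M) := by
  obtain ⟨N, P, i, f, hN, hP, hi, hf, hk⟩ := exists_cosyz h2 M hM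
  have := hP.1
  have := hP.2
  rw [injective_iff_map_eq_zero]
  intro m hm
  apply hi
  rw [map_zero, ← Module.forall_dual_apply_eq_zero_iff R]
  intro φ
  exact LinearMap.congr_fun hm (φ.comp i)

lemma eval_bijective [IsNoetherianRing R] {X : ModuleCat.{0} R → Prop} (hX : Resolving R X)
    (h2 : ∀ M, X M → ∃ N, X N ∧ IsSyzygy R M N) (M : ModuleCat.{0} R) (hM : X M) :
    Function.Bijective (Module.Dual.eval R M) := by
  refine ⟨eval_injective h2 M hM, fun ξ => ?_⟩
  obtain ⟨N, P, i, f, hN, hP, hif⟩ := exists_cosyz h2 M hM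
  have := hP.1
  have := hP.2
  have hfi : ∀ m, f (i m) = 0 := fun m => by
    have : i m ∈ LinearMap.ker f := hif.2.2 ▸ LinearMap.mem_range_self i m
    exact this
  obtain ⟨p, hp⟩ := (Module.bijective_dual_eval R P).2 (ξ.comp i.dualMap)
  have hp' : ∀ φ : Module.Dual R P, φ p = ξ (φ.comp i) := fun φ => LinearMap.congr_fun hp φ
  have hfp : f p = 0 := by
    apply eval_injective h2 N hN
    rw [map_zero]
    ext ψ
    change (ψ.comp f) p = 0
    rw [hp']
    have : (ψ.comp f).comp i = 0 := by ext m; simp [hfi]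
    rw [this, map_zero]
  have hpr : p ∈ LinearMap.range i := hif.2.2 ▸ (LinearMap.mem_ker.2 hfp)
  obtain ⟨m, rfl⟩ := hpr
  refine ⟨m, ?_⟩
  ext ψ
  obtain ⟨φ, rfl⟩ := extend_functional hX h2 M P N i f hif hN ψ
  exact hp' φ

end Main

end Paper


/-- a resolving subcategory `X` with `ΩX = X` consists of totally
reflexive modules. -/
theorem stmt4 (R : Type) [CommRing R] [IsNoetherianRing R]
    (X : ModuleCat.{0} R → Prop) (hX : Resolving R X)
    (h1 : ∀ M, X M → ∀ N, IsSyzygy R N M → X N)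
    (h2 : ∀ M, X M → ∃ N, X N ∧ IsSyzygy R M N) :
    ∀ M, X M → TotallyReflexive R M := by
  intro M hM
  refine ⟨eval_bijective hX h2 M hM, ?_⟩
  intro i hi
  obtain ⟨n, rfl⟩ : ∃ n, i = n + 1 := ⟨i - 1, by omega⟩
  constructor
  · refine extVanish_of_abelianExt _ _ _ (ext_zero_of_class X _ ?_ n M hM)
    intro M hM
    have := hX.fg M hM
    obtain ⟨k, q, hq⟩ := Module.Finite.exists_fin' R M
    let P : ModuleCat.{0} R := ModuleCat.of R (Fin k → R)
    let q' : P →ₗ[R] M := q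
    let K : ModuleCat.{0} R := ModuleCat.of R (LinearMap.ker q)
    let j : K →ₗ[R] P := (LinearMap.ker q).subtype
    have hP : FGProj R P := by
      constructor
      · change Module.Finite R (Fin k → R)
        infer_instance
      · change Module.Projective R (Fin k → R)
        infer_instance
    have hses : SES R j q' := ⟨Submodule.injective_subtype _, hq, (Submodule.range_subtype _).symm⟩
    exact ⟨K, P, j, q', h1 M hM K ⟨P, q', hP, hq, ⟨LinearEquiv.refl R _⟩⟩, hP.2, hses,
      fun g => extend_functional hX h2 K P M j q' hses hM g⟩
  · refine extVanish_of_abelianExt _ _ _ (ext_zero_of_class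
      (fun D => ∃ M, X M ∧ D = ModuleCat.of R (Module.Dual R M)) _ ?_ n _ ⟨M, hM, rfl⟩)
    rintro _ ⟨M, hM, rfl⟩
    obtain ⟨N, P, i, f, hN, hP, hif⟩ := exists_cosyz h2 M hM
    have := hP.1
    have := hP.2
    have hfi : ∀ m, f (i m) = 0 := fun m => by
      have : i m ∈ LinearMap.ker f := hif.2.2 ▸ LinearMap.mem_range_self i m
      exact this
    let D : ModuleCat.{0} R := ModuleCat.of R (Module.Dual R N)
    let Q : ModuleCat.{0} R := ModuleCat.of R (Module.Dual R P)
    let E : ModuleCat.{0} R := ModuleCat.of R (Module.Dual R M)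
    let a : D →ₗ[R] Q := f.dualMap
    let b : Q →ₗ[R] E := i.dualMap
    refine ⟨D, Q, a, b, ⟨N, hN, rfl⟩, ?_, ⟨?_, ?_, ?_⟩, ?_⟩
    · change Module.Projective R (Module.Dual R P)
      infer_instance
    · exact LinearMap.dualMap_injective_of_surjective hif.2.1
    · intro ψ
      exact extend_functional hX h2 M P N i f hif hN ψ
    · have hex : Function.Exact i f := LinearMap.exact_iff.2 hif.2.2
      ext φ
      constructor
      · intro hφ
        have hφ' : ∀ m, (φ : Module.Dual R P) (i m) = 0 := fun m =>
          LinearMap.congr_fun (show i.dualMap φ = 0 from hφ) m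
        have hle : LinearMap.ker f ≤ LinearMap.ker (φ : Module.Dual R P) := by
          rw [hif.2.2]
          rintro _ ⟨m, rfl⟩
          exact hφ' m
        refine ⟨((LinearMap.ker f).liftQ (φ : Module.Dual R P) hle).comp
          (f.quotKerEquivOfSurjective hif.2.1).symm.toLinearMap, ?_⟩
        refine LinearMap.ext fun y => ?_
        have hy : (f.quotKerEquivOfSurjective hif.2.1).symm (f y) = (LinearMap.ker f).mkQ y := by
          rw [LinearEquiv.symm_apply_eq]; rfl
        change (LinearMap.ker f).liftQ (φ : Module.Dual R P) hle
          ((f.quotKerEquivOfSurjective hif.2.1).symm (f y)) = _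
        rw [hy]
        rfl
      · rintro ⟨ψ, rfl⟩
        refine LinearMap.ext fun m => ?_
        change (ψ : Module.Dual R N) (f (i m)) = 0
        rw [hfi, map_zero]
    · intro g
      obtain ⟨n, hn⟩ := (eval_bijective hX h2 N hN).2 g
      obtain ⟨p, rfl⟩ := hif.2.1 n
      refine ⟨Module.Dual.eval R P p, ?_⟩
      rw [← hn]
      rfl
end
end

section
/- Let I be an ideal of a commutative Noetherian ring R, and let M, C be finitely generated R-modules with M in the ball [C]_n of radius n centered at C. Then for every t ≥ 0, the ideal (∏_{i=0}^{t} a_I^i(R)·a_I^i(C))^n is contained in a_I^t(M), where a_I^i(N) denotes the annihilator of the i-th local cohomology module H^i_I(N). -/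
open CategoryTheory

noncomputable section

open Paper

noncomputable section

open CategoryTheory Limits Opposite

namespace Paper5

variable {R : Type} [CommRing R]

abbrev K (X Y : ModuleCat.{0} R) : CochainComplex (ModuleCat.{0} R) ℕ :=
  (projectiveResolution X).complex.linearYonedaObj R Y

def Kmap (X : ModuleCat.{0} R) {Y Y' : ModuleCat.{0} R} (f : Y ⟶ Y') : K X Y ⟶ K X Y' :=
  (HomologicalComplex.unopFunctor _ _).map
    ((NatTrans.mapHomologicalComplex (NatTrans.rightOp ((linearYoneda R (ModuleCat.{0} R)).map f)) _).app
      (projectiveResolution X).complex).op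

lemma Kmap_f (X : ModuleCat.{0} R) {Y Y' : ModuleCat.{0} R} (f : Y ⟶ Y') (i : ℕ)
   (z : (projectiveResolution X).complex.X i ⟶ Y) :
   ((Kmap X f).f i).hom z = z ≫ f := rfl

def Kpre {X X' : ModuleCat.{0} R} (g : X ⟶ X') (Y : ModuleCat.{0} R) : K X' Y ⟶ K X Y :=
  (HomologicalComplex.unopFunctor _ _).map
    ((((linearYoneda R _).obj Y).rightOp.mapHomologicalComplex _).map
      (ProjectiveResolution.lift g (projectiveResolution X) (projectiveResolution X'))).op

lemma Kpre_f {X X' : ModuleCat.{0} R} (g : X ⟶ X') (Y : ModuleCat.{0} R) (i : ℕ)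
   (z : (projectiveResolution X').complex.X i ⟶ Y) :
   ((Kpre g Y).f i).hom z = 
    (ProjectiveResolution.lift g (projectiveResolution X) (projectiveResolution X')).f i ≫ z := rfl


lemma homologyUnop_nat {V : Type*} [Category* V] [Abelian V] {c : ComplexShape ℕ}
    {A B : HomologicalComplex Vᵒᵖ c} (α : A ⟶ B) (i : ℕ) :
    HomologicalComplex.homologyMap ((HomologicalComplex.unopFunctor V c).map α.op) i ≫
      (A.homologyUnop i).hom =
      (B.homologyUnop i).hom ≫ (HomologicalComplex.homologyMap α i).unop := by
  have h := HomologicalComplex.homologyOp_hom_naturality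
    ((HomologicalComplex.unopFunctor V c).map α.op) i
  have h2 : HomologicalComplex.homologyMap α i ≫ (B.unop.homologyOp i).hom =
      (A.unop.homologyOp i).hom ≫ 
        (HomologicalComplex.homologyMap ((HomologicalComplex.unopFunctor V c).map α.op) i).op := h
  have h3 := congrArg Quiver.Hom.unop h2
  exact h3.symm

lemma unop_aux {V : Type*} [Category* V] {A A' H H' : Vᵒᵖ} (iA : A ≅ H) (iA' : A' ≅ H')
    {α : A' ⟶ A} {β : H' ⟶ H} (h : α = iA'.hom ≫ β ≫ iA.inv) {L L' : V}
    (u : L ≅ unop H) (u' : L' ≅ unop H') (γ : L ⟶ L') (w : γ ≫ u'.hom = u.hom ≫ β.unop) :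
    α.unop ≫ (iA'.unop.symm ≪≫ u'.symm).hom = (iA.unop.symm ≪≫ u.symm).hom ≫ γ := by
  have w' : u.inv ≫ γ = β.unop ≫ u'.inv := by
    rw [Iso.inv_comp_eq, ← Category.assoc, ← w, Category.assoc, Iso.hom_inv_id, Category.comp_id]
  have e : iA'.hom.unop ≫ iA'.inv.unop = 𝟙 _ := by
    rw [← unop_comp, Iso.inv_hom_id, unop_id]
  subst h
  simp [w', reassoc_of% e]

lemma ext_map (n : ℕ) (X : ModuleCat.{0} R) {Y Y' : ModuleCat.{0} R} (f : Y ⟶ Y') :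
    ((Ext R (ModuleCat.{0} R) n).obj (op X)).map f ≫
      ((projectiveResolution X).isoExt n Y').hom =
    ((projectiveResolution X).isoExt n Y).hom ≫ HomologicalComplex.homologyMap (Kmap X f) n :=
  unop_aux _ _ (ProjectiveResolution.leftDerived_app_eq
    (NatTrans.rightOp ((linearYoneda R (ModuleCat.{0} R)).map f)) (projectiveResolution X) n)
    _ _ _ (homologyUnop_nat _ n)

lemma ext_pre (n : ℕ) {X X' : ModuleCat.{0} R} (g : X ⟶ X') (Y : ModuleCat.{0} R) :
    ((Ext R (ModuleCat.{0} R) n).map g.op).app Y ≫ ((projectiveResolution X).isoExt n Y).hom =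
    ((projectiveResolution X').isoExt n Y).hom ≫ HomologicalComplex.homologyMap (Kpre g Y) n :=
  unop_aux _ _ (Functor.leftDerived_map_eq
    (((linearYoneda R (ModuleCat.{0} R)).obj Y).rightOp) n g
    (ProjectiveResolution.lift g (projectiveResolution X) (projectiveResolution X'))
    (ProjectiveResolution.lift_commutes _ _ _))
    _ _ _ (homologyUnop_nat _ n)

/-- local cohomology -/
abbrev Dg (I : Ideal R) (t : ℕ) := localCohomology.diagram (localCohomology.idealPowersDiagram I) t

def coc (I : Ideal R) (t : ℕ) (j : ℕᵒᵖᵒᵖ) : (Dg I t).obj j ⟶ localCohomology I t :=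
  colimit.ι (Dg I t) j

lemma coc_rep (I : Ideal R) (t : ℕ) (M : ModuleCat.{0} R) (x : (localCohomology I t).obj M) :
    ∃ (j : ℕᵒᵖᵒᵖ) (z : ((Dg I t).obj j).obj M), ((coc I t j).app M).hom z = x := by
  have hc := isColimitOfPreserves ((evaluation (ModuleCat.{0} R) (ModuleCat.{0} R)).obj M) (colimit.isColimit (Dg I t))
  obtain ⟨j, z, h⟩ := Concrete.isColimit_exists_rep _ hc x
  exact ⟨j, z, h⟩

lemma coc_zero (I : Ideal R) (t : ℕ) (M : ModuleCat.{0} R) (j : ℕᵒᵖᵒᵖ)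
    (z : ((Dg I t).obj j).obj M) (hz : ((coc I t j).app M).hom z = 0) :
    ∃ (j' : ℕᵒᵖᵒᵖ) (f : j ⟶ j'), (((Dg I t).map f).app M).hom z = 0 := by
  have hc := isColimitOfPreserves ((evaluation (ModuleCat.{0} R) (ModuleCat.{0} R)).obj M) (colimit.isColimit (Dg I t))
  obtain ⟨k, f, g, h⟩ := Concrete.isColimit_exists_of_rep_eq _ hc z (0 : ((Dg I t).obj j).obj M)
    (hz.trans (map_zero ((coc I t j).app M).hom).symm)
  exact ⟨k, f, h.trans (map_zero ((((Dg I t).map g).app M).hom))⟩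

lemma coc_w (I : Ideal R) (t : ℕ) (M : ModuleCat.{0} R) {j j' : ℕᵒᵖᵒᵖ} (f : j ⟶ j')
    (z : ((Dg I t).obj j).obj M) :
    ((coc I t j').app M).hom ((((Dg I t).map f).app M).hom z) = ((coc I t j).app M).hom z := by
  have := congr_app (colimit.w (Dg I t) f) M
  exact congrArg (fun φ => φ.hom z) this

lemma coc_nat (I : Ideal R) (t : ℕ) {M N : ModuleCat.{0} R} (f : M ⟶ N) (j : ℕᵒᵖᵒᵖ)
    (z : ((Dg I t).obj j).obj M) :
    ((localCohomology I t).map f).hom (((coc I t j).app M).hom z) =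
     ((coc I t j).app N).hom ((((Dg I t).obj j).map f).hom z) := by
  have := (coc I t j).naturality f
  exact congrArg (fun φ => φ.hom z) this.symm

lemma Kmap_add (X : ModuleCat.{0} R) {Y Y' : ModuleCat.{0} R} (f g : Y ⟶ Y') :
    Kmap X (f + g) = Kmap X f + Kmap X g := by
  ext i z
  change (Kmap X (f+g)).f i z = (Kmap X f).f i z + (Kmap X g).f i z
  exact Preadditive.comp_add (C := ModuleCat.{0} R) _ _ _ z f g

lemma ext_add (n : ℕ) (X : ModuleCat.{0} R) {Y Y' : ModuleCat.{0} R} (f g : Y ⟶ Y') :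
   ((Ext R (ModuleCat.{0} R) n).obj (op X)).map (f + g) =
   ((Ext R (ModuleCat.{0} R) n).obj (op X)).map f + ((Ext R (ModuleCat.{0} R) n).obj (op X)).map g := by
  rw [← cancel_mono ((projectiveResolution X).isoExt n Y').hom, Preadditive.add_comp]
  simp only [ext_map]
  rw [← Preadditive.comp_add, Kmap_add, HomologicalComplex.homologyMap_add]

instance (I : Ideal R) (t : ℕ) : (localCohomology I t).Additive where
  map_add {M N f g} := by
    ext x
    obtain ⟨j, z, rfl⟩ := coc_rep I t M x
    change ((localCohomology I t).map (f + g)).hom _ = ((localCohomology I t).map f).hom _ + ((localCohomology I t).map g).hom _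
    rw [coc_nat, coc_nat, coc_nat, ← map_add]
    congr 1
    exact congrArg (fun φ => φ.hom z) (ext_add t _ f g)

/-! exactness -/

def KS (X : ModuleCat.{0} R) (S : ShortComplex (ModuleCat.{0} R)) :
    ShortComplex (CochainComplex (ModuleCat.{0} R) ℕ) :=
  ShortComplex.mk (Kmap X S.f) (Kmap X S.g) (by
    ext i z
    exact (Category.assoc (obj := ModuleCat.{0} R) z S.f S.g).trans
      (by rw [S.zero]; exact comp_zero))

lemma KS_exact (X : ModuleCat.{0} R) {S : ShortComplex (ModuleCat.{0} R)} (hS : S.ShortExact) :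
    (KS X S).ShortExact := by
  apply HomologicalComplex.shortExact_of_degreewise_shortExact
  intro i
  have := hS.mono_f
  have := hS.epi_g
  refine ShortComplex.ShortExact.mk' ?_ ?_ ?_
  · rw [ShortComplex.moduleCat_exact_iff]
    intro (z : (projectiveResolution X).complex.X i ⟶ S.X₂) (hz : z ≫ S.g = 0)
    exact ⟨hS.exact.lift z hz, hS.exact.lift_f _ _⟩
  · rw [ModuleCat.mono_iff_injective]
    intro (z : (projectiveResolution X).complex.X i ⟶ S.X₁) z' (h : z ≫ S.f = z' ≫ S.f)
    exact (cancel_mono S.f).1 h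
  · rw [ModuleCat.epi_iff_surjective]
    intro (z : (projectiveResolution X).complex.X i ⟶ S.X₃)
    exact ⟨Projective.factorThru z S.g, Projective.factorThru_comp z S.g⟩

def KSpre {X X' : ModuleCat.{0} R} (g : X ⟶ X') (S : ShortComplex (ModuleCat.{0} R)) :
    KS X' S ⟶ KS X S where
  τ₁ := Kpre g S.X₁
  τ₂ := Kpre g S.X₂
  τ₃ := Kpre g S.X₃
  comm₁₂ := by
    ext i z
    exact (Category.assoc (obj := ModuleCat.{0} R) _ z _)
  comm₂₃ := by
    ext i z
    exact (Category.assoc (obj := ModuleCat.{0} R) _ z _)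

def del (X : ModuleCat.{0} R) {S : ShortComplex (ModuleCat.{0} R)} (hS : S.ShortExact) (n : ℕ) :
    ((Ext R (ModuleCat.{0} R) n).obj (op X)).obj S.X₃ ⟶ 
    ((Ext R (ModuleCat.{0} R) (n+1)).obj (op X)).obj S.X₁ :=
  ((projectiveResolution X).isoExt n S.X₃).hom ≫ (KS_exact X hS).δ n (n+1) (by simp) ≫
   ((projectiveResolution X).isoExt (n+1) S.X₁).inv

lemma del_aux {V : Type*} [Category* V] {A B A' B' a b a' b' : V} (eA : A ≅ a) (eB : B ≅ b)
    (eA' : A' ≅ a') (eB' : B' ≅ b') (d : a ⟶ b) (d' : a' ⟶ b') (p : A ⟶ A') (q : B ⟶ B')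
    (p' : a ⟶ a') (q' : b ⟶ b') (hp : p ≫ eA'.hom = eA.hom ≫ p') (hq : q ≫ eB'.hom = eB.hom ≫ q')
    (h : d ≫ q' = p' ≫ d') :
    p ≫ (eA'.hom ≫ d' ≫ eB'.inv) = (eA.hom ≫ d ≫ eB.inv) ≫ q := by
  rw [← cancel_mono eB'.hom]
  simp [hq, reassoc_of% hp, h]

lemma del_nat {X X' : ModuleCat.{0} R} (g : X ⟶ X') {S : ShortComplex (ModuleCat.{0} R)}
    (hS : S.ShortExact) (n : ℕ) :
    ((Ext R (ModuleCat.{0} R) n).map g.op).app S.X₃ ≫ del X hS n =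
    del X' hS n ≫ ((Ext R (ModuleCat.{0} R) (n+1)).map g.op).app S.X₁ :=
  del_aux _ _ _ _ _ _ _ _ _ _ (ext_pre n g S.X₃) (ext_pre (n+1) g S.X₁)
    (HomologicalComplex.HomologySequence.δ_naturality (KSpre g S) (KS_exact X' hS)
      (KS_exact X hS) n (n+1) (by simp))

lemma exact_aux {A B C A' B' C' : ModuleCat.{0} R} (eA : A ≅ A') (eB : B ≅ B') (eC : C ≅ C')
    (f : A ⟶ B) (g : B ⟶ C) (f' : A' ⟶ B') (g' : B' ⟶ C')
    (hf : f ≫ eB.hom = eA.hom ≫ f') (hg : g ≫ eC.hom = eB.hom ≫ g')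
    (h : ∀ b, g'.hom b = 0 → ∃ a, f'.hom a = b) (b : B) (hb : g.hom b = 0) :
    ∃ a, f.hom a = b := by
  have h1 : g'.hom (eB.hom.hom b) = 0 := by
    have := congrArg (fun φ => φ.hom b) hg
    simp only [ModuleCat.hom_comp, LinearMap.comp_apply, hb, map_zero] at this
    exact this.symm
  obtain ⟨a, ha⟩ := h _ h1
  refine ⟨eA.inv.hom a, ?_⟩
  have e : eA.inv ≫ f = f' ≫ eB.inv := by
    rw [Iso.inv_comp_eq, ← Category.assoc, ← hf, Category.assoc, Iso.hom_inv_id, Category.comp_id]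
  have := congrArg (fun φ => φ.hom a) e
  simp only [ModuleCat.hom_comp, LinearMap.comp_apply, ha] at this
  rw [this]
  exact congrArg (fun φ => φ.hom b) eB.hom_inv_id

lemma del_comp_aux {V : Type*} [Category* V] {A B a b : V} (eA : A ≅ a) (eB : B ≅ b) (d : a ⟶ b) :
    (eA.hom ≫ d ≫ eB.inv) ≫ eB.hom = eA.hom ≫ d := by simp

lemma del_exact (X : ModuleCat.{0} R) {S : ShortComplex (ModuleCat.{0} R)}
    (hS : S.ShortExact) (n : ℕ) (z : ((Ext R (ModuleCat.{0} R) (n+1)).obj (op X)).obj S.X₁)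
    (hz : (((Ext R (ModuleCat.{0} R) (n+1)).obj (op X)).map S.f).hom z = 0) :
    ∃ y, (del X hS n).hom y = z := by
  have h := (KS_exact X hS).homology_exact₁ n (n+1) (by simp)
  rw [ShortComplex.moduleCat_exact_iff] at h
  exact exact_aux ((projectiveResolution X).isoExt n S.X₃)
    ((projectiveResolution X).isoExt (n+1) S.X₁) ((projectiveResolution X).isoExt (n+1) S.X₂)
    (del X hS n) _ _ _ (del_comp_aux _ _ _) (ext_map (n+1) X S.f) h z hz

lemma mid_exact (X : ModuleCat.{0} R) {S : ShortComplex (ModuleCat.{0} R)}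
    (hS : S.ShortExact) (n : ℕ) (z : ((Ext R (ModuleCat.{0} R) n).obj (op X)).obj S.X₂)
    (hz : (((Ext R (ModuleCat.{0} R) n).obj (op X)).map S.g).hom z = 0) :
    ∃ y, (((Ext R (ModuleCat.{0} R) n).obj (op X)).map S.f).hom y = z := by
  have h := (KS_exact X hS).homology_exact₂ n
  rw [ShortComplex.moduleCat_exact_iff] at h
  exact exact_aux ((projectiveResolution X).isoExt n S.X₁)
    ((projectiveResolution X).isoExt n S.X₂) ((projectiveResolution X).isoExt n S.X₃)
    _ _ _ _ (ext_map n X S.f) (ext_map n X S.g) h z hz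

lemma KS_mono_zero (X : ModuleCat.{0} R) {S : ShortComplex (ModuleCat.{0} R)}
    (hS : S.ShortExact) : Mono (HomologicalComplex.homologyMap (Kmap X S.f) 0) := by
  have h0 : Mono (Kmap X S.f) := (KS_exact X hS).mono_f
  have h1 : Mono (HomologicalComplex.cyclesMap (Kmap X S.f) 0) := inferInstance
  have h2 := HomologicalComplex.homologyπ_naturality (Kmap X S.f) 0
  have hd : ∀ Y, IsIso ((K X Y).homologyπ 0) := fun Y => inferInstance
  have := hd S.X₁
  have := hd S.X₂
  rw [← IsIso.eq_inv_comp] at h2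
  rw [h2]
  infer_instance

lemma zero_inj (X : ModuleCat.{0} R) {S : ShortComplex (ModuleCat.{0} R)}
    (hS : S.ShortExact) (z : ((Ext R (ModuleCat.{0} R) 0).obj (op X)).obj S.X₁)
    (hz : (((Ext R (ModuleCat.{0} R) 0).obj (op X)).map S.f).hom z = 0) : z = 0 := by
  have hmono := KS_mono_zero X hS
  have : Mono (((Ext R (ModuleCat.{0} R) 0).obj (op X)).map S.f) := by
    have : Mono (((Ext R (ModuleCat.{0} R) 0).obj (op X)).map S.f ≫
        ((projectiveResolution X).isoExt 0 S.X₂).hom) := by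
      rw [ext_map]; infer_instance
    exact mono_of_mono _ ((projectiveResolution X).isoExt 0 S.X₂).hom
  rw [ModuleCat.mono_iff_injective] at this
  exact this (hz.trans (map_zero _).symm)

/-! ### annihilators -/

lemma mem_aa {I : Ideal R} {t : ℕ} {M : ModuleCat.{0} R} {r : R} :
    r ∈ aa R I t M ↔ ∀ x : (localCohomology I t).obj M, r • x = 0 :=
  Module.mem_annihilator

lemma mem_aa_iff {I : Ideal R} {t : ℕ} {M : ModuleCat.{0} R} {r : R} :
    r ∈ aa R I t M ↔ ∀ j (z : ((Dg I t).obj j).obj M),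
      ((coc I t j).app M).hom (r • z) = 0 := by
  rw [mem_aa]
  constructor
  · intro h j z
    rw [map_smul, h]
  · intro h x
    obtain ⟨j, z, rfl⟩ := coc_rep I t M x
    rw [← map_smul, h]

lemma aa_retract (I : Ideal R) (t : ℕ) {M N : ModuleCat.{0} R} (i : M ⟶ N) (p : N ⟶ M)
    (h : i ≫ p = 𝟙 M) : aa R I t N ≤ aa R I t M := by
  intro r hr
  rw [mem_aa] at hr ⊢
  intro x
  have h1 : (localCohomology I t).map i ≫ (localCohomology I t).map p = 𝟙 _ := by
    rw [← Functor.map_comp, h, CategoryTheory.Functor.map_id]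
  have h2 : ((localCohomology I t).map p).hom (((localCohomology I t).map i).hom x) = x :=
    congrArg (fun φ => φ.hom x) h1
  rw [← h2, ← map_smul, ← map_smul, map_smul _ r x, hr, map_zero]

lemma aa_pi (I : Ideal R) (t : ℕ) {k : ℕ} (f : Fin k → ModuleCat.{0} R) (J : Ideal R)
    (h : ∀ i, J ≤ aa R I t (f i)) : J ≤ aa R I t (ModuleCat.of R ((i : Fin k) → f i)) := by
  intro r hr
  rw [mem_aa]
  intro x
  let p (i : Fin k) : ModuleCat.of R ((i : Fin k) → f i) ⟶ f i :=
    ModuleCat.ofHom (LinearMap.proj i)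
  let q (i : Fin k) : f i ⟶ ModuleCat.of R ((i : Fin k) → f i) :=
    ModuleCat.ofHom (LinearMap.single R (fun i => f i) i)
  have h1 : ∑ i, p i ≫ q i = 𝟙 (ModuleCat.of R ((i : Fin k) → f i)) := by
    apply ModuleCat.hom_ext
    rw [ModuleCat.hom_sum]
    refine LinearMap.ext fun y => ?_
    rw [LinearMap.sum_apply]
    exact Finset.univ_sum_single y
  have h2 : ∑ i, (localCohomology I t).map (p i) ≫ (localCohomology I t).map (q i) = 𝟙 _ := by
    simp only [← Functor.map_comp]
    rw [← Functor.map_sum, h1, CategoryTheory.Functor.map_id]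
  have h3 : ∑ i, ((localCohomology I t).map (q i)).hom
      (((localCohomology I t).map (p i)).hom x) = x := by
    have := congrArg (fun φ => φ.hom x) h2
    simp only [ModuleCat.hom_sum, LinearMap.sum_apply] at this
    exact this
  rw [← h3, Finset.smul_sum]
  refine Finset.sum_eq_zero fun i _ => ?_
  rw [← map_smul, mem_aa.1 (h i hr), map_zero]

lemma dg_nat (I : Ideal R) (t : ℕ) {j j' : ℕᵒᵖᵒᵖ} (φ : j ⟶ j') {M N : ModuleCat.{0} R}
    (f : M ⟶ N) (z : ((Dg I t).obj j).obj M) :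
    (((Dg I t).map φ).app N).hom ((((Dg I t).obj j).map f).hom z) =
    (((Dg I t).obj j').map f).hom ((((Dg I t).map φ).app M).hom z) :=
  congrArg (fun ψ => ψ.hom z) (((Dg I t).map φ).naturality f)

lemma aa_mid (I : Ideal R) (t : ℕ) {S : ShortComplex (ModuleCat.{0} R)} (hS : S.ShortExact) :
    aa R I t S.X₁ * aa R I t S.X₃ ≤ aa R I t S.X₂ := by
  rw [Ideal.mul_le]
  intro s hs r hr
  rw [mem_aa_iff]
  intro j z
  have h1 := mem_aa_iff.1 hr j ((((Dg I t).obj j).map S.g).hom z)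
  rw [← map_smul] at h1
  obtain ⟨j', φ, h2⟩ := coc_zero I t _ j _ h1
  rw [dg_nat] at h2
  obtain ⟨y, hy⟩ : ∃ y : ((Dg I t).obj j').obj S.X₁, (((Dg I t).obj j').map S.f).hom y =
    (((Dg I t).map φ).app S.X₂).hom (r • z) := mid_exact _ hS t _ h2
  rw [← coc_w I t S.X₂ φ, mul_smul, map_smul _ s, ← hy, ← map_smul, ← coc_nat,
    mem_aa_iff.1 hs, map_zero]

lemma aa_zero (I : Ideal R) {S : ShortComplex (ModuleCat.{0} R)} (hS : S.ShortExact) :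
    aa R I 0 S.X₂ ≤ aa R I 0 S.X₁ := by
  intro r hr
  rw [mem_aa_iff]
  intro j z
  have h1 := mem_aa_iff.1 hr j ((((Dg I 0).obj j).map S.f).hom z)
  rw [← map_smul] at h1
  obtain ⟨j', φ, h2⟩ := coc_zero I 0 _ j _ h1
  rw [dg_nat] at h2
  have h3 : (((Dg I 0).map φ).app S.X₁).hom (r • z) = 0 := zero_inj _ hS _ h2
  rw [← coc_w I 0 S.X₁ φ, h3, map_zero]

lemma aa_del (I : Ideal R) (t : ℕ) {S : ShortComplex (ModuleCat.{0} R)} (hS : S.ShortExact) :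
    aa R I t S.X₃ * aa R I (t+1) S.X₂ ≤ aa R I (t+1) S.X₁ := by
  rw [Ideal.mul_le]
  intro s hs r hr
  rw [mem_aa_iff]
  intro j z
  have h1 := mem_aa_iff.1 hr j ((((Dg I (t+1)).obj j).map S.f).hom z)
  rw [← map_smul] at h1
  obtain ⟨j', φ, h2⟩ := coc_zero I (t+1) _ j _ h1
  rw [dg_nat] at h2
  let X (j : ℕᵒᵖᵒᵖ) : ModuleCat.{0} R := (((localCohomology.ringModIdeals
    (localCohomology.idealPowersDiagram I)).op).obj j).unop
  let d (j : ℕᵒᵖᵒᵖ) : ((Dg I t).obj j).obj S.X₃ ⟶ ((Dg I (t+1)).obj j).obj S.X₁ :=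
    del (X j) hS t
  obtain ⟨y, hy⟩ : ∃ y : ((Dg I t).obj j').obj S.X₃, (d j').hom y =
    (((Dg I (t+1)).map φ).app S.X₁).hom (r • z) := del_exact _ hS t _ h2
  have h3 := mem_aa_iff.1 hs j' y
  obtain ⟨j'', ψ, h4⟩ := coc_zero I t _ j' _ h3
  have hn : (d j'').hom ((((Dg I t).map ψ).app S.X₃).hom (s • y)) =
      (((Dg I (t+1)).map ψ).app S.X₁).hom ((d j').hom (s • y)) :=
    congrArg (fun φ => φ.hom (s • y)) (del_nat
      ((localCohomology.ringModIdeals (localCohomology.idealPowersDiagram I)).map ψ.unop) hS t)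
  rw [h4, map_zero, map_smul, hy] at hn
  rw [← coc_w I (t+1) S.X₁ φ, mul_smul, map_smul _ s, ← coc_w I (t+1) S.X₁ ψ, ← hn, map_zero]

lemma ses_exact {L M N : ModuleCat.{0} R} {f : L →ₗ[R] M} {g : M →ₗ[R] N} (h : SES R f g) :
    ∃ w, (ShortComplex.mk (ModuleCat.ofHom f) (ModuleCat.ofHom g) w).ShortExact := by
  obtain ⟨h1, h2, h3⟩ := h
  have w : ModuleCat.ofHom f ≫ ModuleCat.ofHom g = 0 := by
    apply ModuleCat.hom_ext
    ext x
    have : f x ∈ LinearMap.ker g := h3 ▸ LinearMap.mem_range_self f x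
    exact this
  refine ⟨w, ShortComplex.ShortExact.mk' ?_ ?_ ?_⟩
  · rw [ShortComplex.moduleCat_exact_iff]
    intro x hx
    have : x ∈ LinearMap.range f := h3 ▸ (show x ∈ LinearMap.ker g from hx)
    exact this
  · rw [ModuleCat.mono_iff_injective]
    exact h1
  · rw [ModuleCat.epi_iff_surjective]
    exact h2

lemma aa_iso (I : Ideal R) (t : ℕ) {M N : ModuleCat.{0} R} (e : M ≃ₗ[R] N) :
    aa R I t N ≤ aa R I t M :=
  aa_retract I t (ModuleCat.ofHom e.toLinearMap) (ModuleCat.ofHom e.symm.toLinearMap)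
    (by apply ModuleCat.hom_ext; ext x; exact e.symm_apply_apply x)

lemma aa_proj (I : Ideal R) (t : ℕ) {P : ModuleCat.{0} R} (hP : FGProj R P) :
    aa R I t (ModuleCat.of R R) ≤ aa R I t P := by
  obtain ⟨h1, h2⟩ := hP
  obtain ⟨k, f, hf⟩ := Module.Finite.exists_fin' R P
  obtain ⟨g, hg⟩ := Module.projective_lifting_property f LinearMap.id hf
  refine (aa_pi I t (fun _ : Fin k => ModuleCat.of R R) _ fun _ => le_rfl).trans ?_
  refine aa_retract I t (ModuleCat.ofHom g) (ModuleCat.ofHom f) ?_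
  apply ModuleCat.hom_ext
  exact hg

/-- closure of annihilation under `add` -/
lemma aa_add (I : Ideal R) (t : ℕ) (J : Ideal R) (Y : ModuleCat.{0} R → Prop)
    (hY : ∀ N, Y N → J ≤ aa R I t N) (M : ModuleCat.{0} R) (hM : AddClosure R Y M) :
    J ≤ aa R I t M := by
  obtain ⟨k, f, N, hf, ⟨e⟩⟩ := hM
  refine (aa_pi I t f J fun i => hY _ (hf i)).trans ?_
  refine aa_retract I t (ModuleCat.ofHom (e.toLinearMap ∘ₗ LinearMap.inl R M N))
    (ModuleCat.ofHom (LinearMap.fst R M N ∘ₗ e.symm.toLinearMap)) ?_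
  apply ModuleCat.hom_ext
  ext x
  simp

/-- the product ideal of the statement -/
def pp (I : Ideal R) (C : ModuleCat.{0} R) (t : ℕ) : Ideal R :=
  ∏ i ∈ Finset.range (t + 1), aa R I i (ModuleCat.of R R) * aa R I i C

lemma pp_le (I : Ideal R) (C : ModuleCat.{0} R) (t : ℕ) :
    pp I C t ≤ aa R I t (ModuleCat.of R R) * aa R I t C := by
  unfold pp
  rw [Finset.prod_range_succ]
  exact Ideal.mul_le_right

lemma pp_pow_le (I : Ideal R) (C : ModuleCat.{0} R) (t n : ℕ) (hn : n ≠ 0) :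
    pp I C t ^ n ≤ aa R I t (ModuleCat.of R R) :=
  (Ideal.pow_le_self hn).trans ((pp_le I C t).trans Ideal.mul_le_left)

/-- annihilation in every degree -/
def Q (I : Ideal R) (C : ModuleCat.{0} R) (n : ℕ) (M : ModuleCat.{0} R) : Prop :=
  ∀ t, pp I C t ^ n ≤ aa R I t M

lemma Q_syz (I : Ideal R) (C : ModuleCat.{0} R) (n : ℕ) (hn : n ≠ 0) {N M : ModuleCat.{0} R}
    (h : IsSyzygy R N M) (hM : Q I C n M) : Q I C n N := by
  obtain ⟨P, f, hP, hf, ⟨e⟩⟩ := h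
  have hs : SES R (L := N) (M := P) (N := M) ((LinearMap.ker f).subtype ∘ₗ e.toLinearMap) f := by
    refine ⟨?_, hf, ?_⟩
    · exact (Submodule.subtype_injective _).comp e.injective
    · rw [LinearMap.range_comp, LinearEquiv.range, Submodule.map_top, Submodule.range_subtype]
  obtain ⟨w, hS⟩ := ses_exact hs
  intro t
  cases t with
  | zero => exact (pp_pow_le I C 0 n hn).trans ((aa_proj I 0 hP).trans (aa_zero I hS))
  | succ t =>
    refine le_trans ?_ (aa_del I t hS)
    have : pp I C (t+1) = pp I C t *
        (aa R I (t+1) (ModuleCat.of R R) * aa R I (t+1) C) := Finset.prod_range_succ _ _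
    rw [this, mul_pow]
    refine Ideal.mul_mono (hM t) ?_
    exact (Ideal.pow_le_self hn).trans (Ideal.mul_le_left.trans (aa_proj I (t+1) hP))

lemma Q_nsyz (I : Ideal R) (C : ModuleCat.{0} R) (n : ℕ) (hn : n ≠ 0) (i : ℕ) :
    ∀ {N M : ModuleCat.{0} R}, IsNthSyzygy R i N M → Q I C n M → Q I C n N := by
  induction i with
  | zero =>
    rintro N M ⟨e⟩ hM t
    exact (hM t).trans (aa_iso I t e)
  | succ i ih =>
    rintro N M ⟨K, hK, hN⟩ hM
    exact Q_syz I C n hn hN (ih hK hM)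

lemma Q_bracket (I : Ideal R) (C : ModuleCat.{0} R) (n : ℕ) (hn : n ≠ 0)
    (Y : ModuleCat.{0} R → Prop) (hY : ∀ M, Y M → Q I C n M) (M : ModuleCat.{0} R)
    (hM : Bracket R Y M) : Q I C n M := by
  intro t
  refine aa_add I t _ _ ?_ M hM
  rintro N (hN | ⟨L, i, hL, hN⟩)
  · exact (pp_pow_le I C t n hn).trans (aa_proj I t hN)
  · exact Q_nsyz I C n hn i hN (hY L hL) t

lemma Q_one (I : Ideal R) (C : ModuleCat.{0} R) (M : ModuleCat.{0} R)
    (hM : Bracket R (fun M => Nonempty (M ≃ₗ[R] C)) M) : Q I C 1 M := by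
  refine Q_bracket I C 1 one_ne_zero _ ?_ M hM
  rintro N ⟨e⟩ t
  rw [pow_one]
  exact (pp_le I C t).trans (Ideal.mul_le_right.trans (aa_iso I t e))

lemma Q_ball (I : Ideal R) (C : ModuleCat.{0} R) (n : ℕ) :
    ∀ M : ModuleCat.{0} R, Ball R C (n+1) M → Q I C (n+1) M := by
  induction n with
  | zero => exact fun M hM => Q_one I C M hM
  | succ n ih =>
    intro M hM
    refine Q_bracket I C (n+2) (by omega) _ ?_ M hM
    rintro N ⟨A, B, f, g, hA, hB, hs⟩ t
    obtain ⟨w, hS⟩ := ses_exact hs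
    refine le_trans ?_ (aa_mid I t hS)
    rw [pow_succ]
    refine Ideal.mul_mono (ih A hA t) ?_
    simpa using Q_one I C B hB t

end Paper5

end

/-- if `M ∈ [C]_n` then `(∏_{i=0}^t a_I^i(R)·a_I^i(C))^n ⊆ a_I^t(M)`. -/
theorem stmt5 (R : Type) [CommRing R] [IsNoetherianRing R] (I : Ideal R)
    (M C : ModuleCat.{0} R) [Module.Finite R M] [Module.Finite R C]
    (n : ℕ) (hn : 0 < n) (hM : Ball R C n M) (t : ℕ) :
    (∏ i ∈ Finset.range (t + 1), aa R I i (ModuleCat.of R R) * aa R I i C) ^ n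
      ≤ aa R I t M := by
  obtain ⟨m, rfl⟩ : ∃ m, n = m + 1 := ⟨n - 1, by omega⟩
  exact Paper5.Q_ball I C m M hM t
end
end

section
/- Let (R, m, k) be a Noetherian local ring and X a resolving subcategory of finitely generated R-modules with Ext^i_R(N, R) ≠ 0 for some i > 0 and some N ∈ X. Then there exists a module M ∈ X which is locally free on the punctured spectrum of R and satisfies Ext^i_R(M, R) ≠ 0. -/
open CategoryTheory

noncomputable section

namespace Stmt7Aux

open CategoryTheory TensorProduct

variable {R : Type} [CommRing R]

/-- the old `Ext` vanishes iff the new one does (positive degree) -/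
lemma extVanish_iff (M Y : ModuleCat.{0} R) (i : ℕ) :
    Paper.ExtVanish R M Y (i + 1) ↔ Subsingleton (Abelian.Ext.{0} M Y (i + 1)) := by
  let P : ProjectiveResolution M := ProjectiveResolution.of M
  have key : Paper.ExtVanish R M Y (i + 1) ↔
      ∀ f : P.complex.X (i + 1) ⟶ Y, P.complex.d (i + 2) (i + 1) ≫ f = 0 →
        ∃ g : P.complex.X i ⟶ Y, P.complex.d (i + 1) i ≫ g = f := by
    unfold Paper.ExtVanish
    rw [← ModuleCat.isZero_iff_subsingleton, (P.isoExt (R := R) (i + 1) Y).isZero_iff,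
      ← HomologicalComplex.exactAt_iff_isZero_homology,
      HomologicalComplex.exactAt_iff' _ i (i + 1) (i + 2) (by simp) (by simp),
      ShortComplex.moduleCat_exact_iff]
    rfl
  rw [key]
  constructor
  · intro h
    refine ⟨fun a b => ?_⟩
    have hz : ∀ a : Abelian.Ext.{0} M Y (i + 1), a = 0 := by
      intro a
      obtain ⟨f, hf, rfl⟩ := P.extMk_surjective a (i + 2) rfl
      rw [P.extMk_eq_zero_iff f (i + 2) rfl hf i rfl]
      exact h f hf
    rw [hz a, hz b]
  · intro h f hf
    rw [← P.extMk_eq_zero_iff f (i + 2) rfl hf i rfl]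
    exact Subsingleton.elim _ _

section
variable {F N : Type} [AddCommGroup F] [Module R F] [AddCommGroup N] [Module R N]

/-- the map `F × N → N`, `(f, n) ↦ π f - x n` -/
abbrev diffMap (p : F →ₗ[R] N) (x : R) : F × N →ₗ[R] N :=
  p.coprod (-(x • LinearMap.id))

lemma diffMap_surj (p : F →ₗ[R] N) (hp : Function.Surjective p) (x : R) :
    Function.Surjective (diffMap p x) := by
  intro n
  obtain ⟨f, rfl⟩ := hp n
  exact ⟨(f, 0), by simp [diffMap]⟩

lemma proj_unit (A : Type) [CommRing A] [Algebra R A] [Module.Projective R F]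
    (p : F →ₗ[R] N) (x : R) (hx : IsUnit (algebraMap R A x)) :
    Module.Projective A (A ⊗[R] (LinearMap.ker (diffMap p x))) := by
  let t : LinearMap.ker (diffMap p x) →ₗ[R] F := (LinearMap.fst R F N).comp (Submodule.subtype _)
  let s : F →ₗ[R] LinearMap.ker (diffMap p x) :=
    LinearMap.codRestrict _ ((x • LinearMap.id).prod p) (by intro f; simp [diffMap])
  have hst : s.comp t = x • LinearMap.id := by
    ext ⟨⟨f, n⟩, h⟩
    · simp [s, t]
    · have h' : p f + -(x • n) = 0 := by simpa [diffMap] using h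
      simp [s, t]
      exact add_neg_eq_zero.mp h'
  obtain ⟨u, hu⟩ := hx
  refine Module.Projective.of_split (t.baseChange A) ((↑u⁻¹ : A) • s.baseChange A) ?_
  rw [LinearMap.smul_comp, ← LinearMap.baseChange_comp, hst, LinearMap.baseChange_smul,
    LinearMap.baseChange_id]
  ext a
  simp [← algebraMap_smul A x, ← hu, smul_smul]

lemma proj_proj (A : Type) [CommRing A] [Algebra R A] [Module.Flat R A] [Module.Projective R F]
    (p : F →ₗ[R] N) (hp : Function.Surjective p) (x : R) [Module.Projective A (A ⊗[R] N)] :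
    Module.Projective A (A ⊗[R] (LinearMap.ker (diffMap p x))) := by
  have : Module.Projective A (A ⊗[R] (F × N)) :=
    Module.Projective.of_equiv (TensorProduct.prodRight R A A F N).symm
  let f := (LinearMap.ker (diffMap p x)).subtype
  have hf : Function.Injective (f.baseChange A) :=
    Module.Flat.lTensor_preserves_injective_linearMap f Subtype.val_injective
  have hg : Function.Surjective ((diffMap p x).baseChange A) :=
    LinearMap.lTensor_surjective A (diffMap_surj p hp x)
  have hex : Function.Exact (f.baseChange A) ((diffMap p x).baseChange A) :=
    Module.Flat.lTensor_exact A (LinearMap.exact_subtype_ker_map (diffMap p x))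
  obtain ⟨l, hl⟩ := Module.projective_lifting_property _ LinearMap.id hg
  obtain ⟨-, r, hr⟩ := (hex.split_tfae'.out 0 1 rfl rfl).mp ⟨hf, l, hl⟩
  exact Module.Projective.of_split _ r hr

end

lemma freeAt_iff (M : ModuleCat.{0} R) [Module.Finite R M] (p : PrimeSpectrum R) :
    Paper.FreeAt R M p ↔
      Module.Projective (Localization.AtPrime p.asIdeal)
        (Localization.AtPrime p.asIdeal ⊗[R] M) := by
  have e := (IsLocalizedModule.isBaseChange p.asIdeal.primeCompl
    (Localization.AtPrime p.asIdeal)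
    (LocalizedModule.mkLinearMap p.asIdeal.primeCompl M)).equiv
  unfold Paper.FreeAt
  constructor
  · intro h
    have hp := Module.Projective.of_free (R := Localization.AtPrime p.asIdeal)
      (P := LocalizedModule p.asIdeal.primeCompl M)
    exact Module.Projective.of_equiv e.symm
  · intro h
    have hfl := Module.Flat.of_projective (R := Localization.AtPrime p.asIdeal)
      (M := Localization.AtPrime p.asIdeal ⊗[R] M)
    have : Module.Free (Localization.AtPrime p.asIdeal)
        (Localization.AtPrime p.asIdeal ⊗[R] M) := Module.free_of_flat_of_isLocalRing
    exact Module.Free.of_equiv e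

/-- The key Ext computation. -/
lemma ext_sub [IsNoetherianRing R] [IsLocalRing R]
    {F N : ModuleCat.{0} R} [Module.Finite R N]
    (p : F →ₗ[R] N) (hp : Function.Surjective p) (x : R)
    (hx : x ∈ IsLocalRing.maximalIdeal R) (Y : ModuleCat.{0} R) [Module.Finite R Y] (i : ℕ)
    (h : Subsingleton (Abelian.Ext.{0} (ModuleCat.of R (LinearMap.ker (diffMap p x))) Y i)) :
    Subsingleton (Abelian.Ext.{0} N Y i) := by
  have hS := LinearMap.shortExact_shortComplexKer (diffMap_surj p hp x)
  let inr : N ⟶ ModuleCat.of R (F × N) := ModuleCat.ofHom (LinearMap.inr R F N)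
  let pr : ModuleCat.of R (F × N) ⟶ N := ModuleCat.ofHom (LinearMap.snd R F N)
  have hc : inr ≫ pr = 𝟙 _ := by ext; simp [inr, pr]
  let g : ModuleCat.of R (F × N) ⟶ N := ModuleCat.ofHom (diffMap p x)
  have hc2 : inr ≫ g = (-x) • 𝟙 N := by
    ext n
    simp [inr, g, diffMap]
  have hsurj : ∀ a : Abelian.Ext.{0} N Y i, ∃ b : Abelian.Ext.{0} N Y i, a = x • b := by
    intro a
    obtain ⟨b, hb⟩ := Abelian.Ext.contravariant_sequence_exact₂ hS Y
      ((Abelian.Ext.mk₀ pr).comp a (zero_add i)) (h.elim _ _)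
    refine ⟨-b, ?_⟩
    have h1 : (Abelian.Ext.mk₀ inr).comp ((Abelian.Ext.mk₀ g).comp b (zero_add i)) (zero_add i) =
        (Abelian.Ext.mk₀ inr).comp ((Abelian.Ext.mk₀ pr).comp a (zero_add i)) (zero_add i) :=
      congrArg (fun z => (Abelian.Ext.mk₀ inr).comp z (zero_add i)) hb
    rw [Abelian.Ext.mk₀_comp_mk₀_assoc, Abelian.Ext.mk₀_comp_mk₀_assoc, hc, hc2,
      Abelian.Ext.mk₀_smul, Abelian.Ext.smul_comp, Abelian.Ext.mk₀_id_comp] at h1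
    rw [Abelian.Ext.mk₀_id_comp] at h1
    rw [← h1]; simp
  have hbot : (⊤ : Submodule R (Abelian.Ext.{0} N Y i)) = ⊥ := by
    refine Submodule.eq_bot_of_le_smul_of_le_jacobson_bot (IsLocalRing.maximalIdeal R) ⊤
      Module.Finite.fg_top ?_ (IsLocalRing.maximalIdeal_le_jacobson ⊥)
    intro a _
    obtain ⟨b, rfl⟩ := hsurj a
    exact Submodule.smul_mem_smul hx trivial
  exact (Submodule.subsingleton_iff R).mp (subsingleton_of_bot_eq_top hbot.symm)

lemma step [IsNoetherianRing R] [IsLocalRing R]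
    {X : ModuleCat.{0} R → Prop} (hX : Paper.Resolving R X) (i : ℕ) (x : R)
    (hx : x ∈ IsLocalRing.maximalIdeal R)
    (N : ModuleCat.{0} R) (hN : X N)
    (hext : ¬ Paper.ExtVanish R N (ModuleCat.of R R) (i + 1)) :
    ∃ M, X M ∧ (∀ p : PrimeSpectrum R, (Paper.FreeAt R N p ∨ x ∉ p.asIdeal) → Paper.FreeAt R M p) ∧
      ¬ Paper.ExtVanish R M (ModuleCat.of R R) (i + 1) := by
  have := hX.fg N hN
  obtain ⟨F, _, _, _, _, π, hπ⟩ := Module.exists_finite_presentation R N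
  let F' : ModuleCat.{0} R := ModuleCat.of R F
  have hF : Paper.FGProj R F' := ⟨inferInstanceAs (Module.Finite R F),
    inferInstanceAs (Module.Projective R F)⟩
  have hFN : X (ModuleCat.of R (F × N)) :=
    hX.extension F' (ModuleCat.of R (F × N)) N (LinearMap.inl R F N) (LinearMap.snd R F N)
      ⟨LinearMap.inl_injective, LinearMap.snd_surjective, (LinearMap.range_inl R F N).symm⟩
      (hX.proj _ hF) hN
  refine ⟨ModuleCat.of R (LinearMap.ker (diffMap π x)), ?_, ?_, ?_⟩
  · exact hX.ker_epi _ (ModuleCat.of R (F × N)) N (LinearMap.ker (diffMap π x)).subtype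
      (diffMap π x) ⟨Subtype.val_injective, diffMap_surj π hπ x,
        (Submodule.range_subtype _).symm⟩ hFN hN
  · intro p hp
    have : Module.Finite R (LinearMap.ker (diffMap π x)) := inferInstance
    rw [freeAt_iff]
    rcases hp with hp | hp
    · rw [freeAt_iff] at hp
      exact proj_proj _ π hπ x
    · exact proj_unit _ π x (IsLocalization.map_units _ (⟨x, hp⟩ : p.asIdeal.primeCompl))
  · rw [extVanish_iff] at hext ⊢
    intro h
    exact hext (ext_sub (F := F') π hπ x hx _ _ h)

lemma iterate [IsNoetherianRing R] [IsLocalRing R]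
    {X : ModuleCat.{0} R → Prop} (hX : Paper.Resolving R X) (i : ℕ) (l : List R)
    (hl : ∀ x ∈ l, x ∈ IsLocalRing.maximalIdeal R)
    (N : ModuleCat.{0} R) (hN : X N)
    (hext : ¬ Paper.ExtVanish R N (ModuleCat.of R R) (i + 1)) :
    ∃ M, X M ∧ (∀ p : PrimeSpectrum R, (∃ x ∈ l, x ∉ p.asIdeal) → Paper.FreeAt R M p) ∧
      ¬ Paper.ExtVanish R M (ModuleCat.of R R) (i + 1) := by
  induction l with
  | nil => exact ⟨N, hN, by simp, hext⟩
  | cons x l ih =>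
    obtain ⟨M, hM, hf, he⟩ := ih (fun y hy => hl y (List.mem_cons_of_mem _ hy))
    obtain ⟨M', hM', hf', he'⟩ := step hX i x (hl x List.mem_cons_self) M hM he
    refine ⟨M', hM', ?_, he'⟩
    rintro p ⟨y, hy, hyp⟩
    rcases List.mem_cons.mp hy with rfl | hy
    · exact hf' p (Or.inr hyp)
    · exact hf' p (Or.inl (hf p ⟨y, hy, hyp⟩))

end Stmt7Aux

open Paper

/-- if some `Ext^i(N,R) ≠ 0` with `N` in a resolving `X`, then some
`M ∈ X` locally free on the punctured spectrum has `Ext^i(M,R) ≠ 0`. -/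
theorem stmt7 (R : Type) [CommRing R] [IsNoetherianRing R] [IsLocalRing R]
    (X : ModuleCat.{0} R → Prop) (hX : Resolving R X) (i : ℕ) (hi : 0 < i)
    (N : ModuleCat.{0} R) (hN : X N)
    (hext : ¬ ExtVanish R N (ModuleCat.of R R) i) :
    ∃ M, X M ∧ LocFreeOnPunctured R M ∧ ¬ ExtVanish R M (ModuleCat.of R R) i := by
  obtain ⟨j, rfl⟩ : ∃ j, i = j + 1 := ⟨i - 1, by omega⟩
  obtain ⟨s, hs⟩ := (IsNoetherian.noetherian (IsLocalRing.maximalIdeal R))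
  obtain ⟨M, hM, hf, he⟩ := Stmt7Aux.iterate hX j s.toList
    (fun x hx => hs ▸ Submodule.subset_span (by simpa using hx)) N hN hext
  refine ⟨M, hM, fun p hp => hf p ?_, he⟩
  by_contra! hcon
  have hle : IsLocalRing.maximalIdeal R ≤ p.asIdeal := by
    rw [← hs]
    exact Submodule.span_le.mpr fun x hx => hcon x (by simpa using hx)
  exact hp (le_antisymm (IsLocalRing.le_maximalIdeal p.2.ne_top) hle)
end
end

section
/- Let (R, m, k) be a Noetherian local ring and let X be a resolving subcategory of finitely generated R-modules that is closed under R-duals (X* ⊆ X) and satisfies Ext^1_R(M, R) = 0 for all M ∈ X. Then every module in X is totally reflexive. -/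
open CategoryTheory

noncomputable section

open Paper

open CategoryTheory.Limits

lemma extVanish_iff {R : Type} [CommRing R] (M N : ModuleCat.{0} R) (n : ℕ) :
    ExtVanish R M N (n+1) ↔ Subsingleton (Abelian.Ext M N (n+1)) := by
  let P := projectiveResolution M
  have h2 : Subsingleton (Abelian.Ext M N (n+1)) ↔
      ∀ f : P.complex.X (n+1) ⟶ N, P.complex.d (n+2) (n+1) ≫ f = 0 →
        ∃ g : P.complex.X n ⟶ N, P.complex.d (n+1) n ≫ g = f := by
    constructor
    · intro h f hf
      exact (P.extMk_eq_zero_iff f (n+2) rfl hf n rfl).1 (Subsingleton.elim _ _)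
    · intro h
      refine ⟨fun a b => ?_⟩
      have key : ∀ a : Abelian.Ext M N (n+1), a = 0 := by
        intro a
        obtain ⟨f, hf, rfl⟩ := P.extMk_surjective a (n+2) rfl
        exact (P.extMk_eq_zero_iff f (n+2) rfl hf n rfl).2 (h f hf)
      rw [key a, key b]
  rw [h2, ExtVanish, ((P.isoExt (R := R) (n+1) N).toLinearEquiv.toEquiv).subsingleton_congr,
    ← ModuleCat.isZero_iff_subsingleton,
    ← HomologicalComplex.exactAt_iff_isZero_homology,
    HomologicalComplex.exactAt_iff' _ n (n+1) (n+2) (by simp) (by simp),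
    ShortComplex.moduleCat_exact_iff]
  exact Iff.rfl

lemma shortExact_of_ses {R : Type} [CommRing R] {K P M : ModuleCat.{0} R}
    (f : K →ₗ[R] P) (g : P →ₗ[R] M) (h : SES R f g) :
    ∃ w, (ShortComplex.mk (ModuleCat.ofHom f) (ModuleCat.ofHom g) w).ShortExact := by
  have w : ModuleCat.ofHom f ≫ ModuleCat.ofHom g = 0 := by
    ext x
    have : f x ∈ LinearMap.ker g := by rw [h.2.2]; exact ⟨x, rfl⟩
    exact this
  refine ⟨w, ?_⟩
  have hm : Mono (ModuleCat.ofHom f) := (ModuleCat.mono_iff_injective _).2 h.1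
  have he : Epi (ModuleCat.ofHom g) := (ModuleCat.epi_iff_surjective _).2 h.2.1
  refine { exact := ?_, mono_f := hm, epi_g := he }
  rw [ShortComplex.moduleCat_exact_iff_range_eq_ker]
  exact h.2.2.symm

lemma ext_shift {R : Type} [CommRing R] {K P M : ModuleCat.{0} R} (N : ModuleCat.{0} R)
    (f : K →ₗ[R] P) (g : P →ₗ[R] M) (h : SES R f g) (hP : FGProj R P) (n : ℕ)
    (hK : Subsingleton (Abelian.Ext K N n)) : Subsingleton (Abelian.Ext M N (n+1)) := by
  obtain ⟨w, hS⟩ := shortExact_of_ses f g h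
  have := hP.2
  have hproj : Projective P := (IsProjective.iff_projective P).1 hP.2
  refine subsingleton_of_forall_eq 0 fun x => ?_
  obtain ⟨y, hy⟩ := Abelian.Ext.contravariant_sequence_exact₃ hS N x
    (@Abelian.Ext.eq_zero_of_projective _ _ _ _ P N n hproj _) (add_comm 1 n)
  rw [← hy, @Subsingleton.elim _ hK y 0, Abelian.Ext.comp_zero]

lemma ext_lift {R : Type} [CommRing R] {K P M : ModuleCat.{0} R} (N : ModuleCat.{0} R)
    (f : K →ₗ[R] P) (g : P →ₗ[R] M) (h : SES R f g)
    (hM : Subsingleton (Abelian.Ext M N 1)) (φ : K →ₗ[R] N) :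
    ∃ ψ : P →ₗ[R] N, ψ.comp f = φ := by
  obtain ⟨w, hS⟩ := shortExact_of_ses f g h
  obtain ⟨y, hy⟩ := Abelian.Ext.contravariant_sequence_exact₁ hS N
    (Abelian.Ext.mk₀ (ModuleCat.ofHom φ)) (add_zero 1) (@Subsingleton.elim _ hM _ _)
  obtain ⟨ψ, rfl⟩ := (Abelian.Ext.mk₀_bijective _ _).2 y
  rw [Abelian.Ext.mk₀_comp_mk₀] at hy
  have := (Abelian.Ext.mk₀_bijective _ _).1 hy
  exact ⟨ψ.hom, by simpa using congrArg ModuleCat.Hom.hom this⟩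

lemma exists_cover {R : Type} [CommRing R] (X : ModuleCat.{0} R → Prop) (hX : Resolving R X)
    (M : ModuleCat.{0} R) (hM : X M) :
    ∃ (K P : ModuleCat.{0} R) (f : K →ₗ[R] P) (g : P →ₗ[R] M), FGProj R P ∧ SES R f g ∧ X K := by
  have := hX.fg M hM
  obtain ⟨n, g, hg⟩ := Module.Finite.exists_fin' R M
  have hP : FGProj R (ModuleCat.of R (Fin n → R)) :=
    ⟨inferInstanceAs (Module.Finite R (Fin n → R)),
      inferInstanceAs (Module.Projective R (Fin n → R))⟩
  have hs : SES R (L := ModuleCat.of R (LinearMap.ker g)) (M := ModuleCat.of R (Fin n → R))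
      (N := M) (LinearMap.ker g).subtype g :=
    ⟨Subtype.val_injective, hg, (Submodule.range_subtype _).symm⟩
  exact ⟨_, _, _, _, hP, hs, hX.ker_epi _ _ _ _ _ hs (hX.proj _ hP) hM⟩


/-- a resolving subcategory closed under `R`-duals with `Ext^1(−,R) = 0`
consists of totally reflexive modules. -/
theorem stmt8 (R : Type) [CommRing R] [IsNoetherianRing R] [IsLocalRing R]
    (X : ModuleCat.{0} R → Prop) (hX : Resolving R X)
    (hdual : ∀ M : ModuleCat.{0} R, X M → X (ModuleCat.of R (Module.Dual R M)))
    (hext : ∀ M, X M → ExtVanish R M (ModuleCat.of R R) 1) :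
    ∀ M, X M → TotallyReflexive R M := by
  have hext1 : ∀ M, X M → Subsingleton (Abelian.Ext M (ModuleCat.of R R) 1) :=
    fun M hM => (extVanish_iff _ _ 0).1 (hext M hM)
  have hall : ∀ n : ℕ, ∀ M, X M → Subsingleton (Abelian.Ext M (ModuleCat.of R R) (n+1)) := by
    intro n
    induction n with
    | zero => exact hext1
    | succ n ih =>
      intro M hM
      obtain ⟨K, P, f, g, hP, hs, hK⟩ := exists_cover X hX M hM
      exact ext_shift _ f g hs hP (n+1) (ih K hK)
  -- the dual of a short exact sequence with last term in `X` is exact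
  have hdualses : ∀ (K P M : ModuleCat.{0} R) (f : K →ₗ[R] P) (g : P →ₗ[R] M), SES R f g → X M →
      SES R (L := ModuleCat.of R (Module.Dual R M)) (M := ModuleCat.of R (Module.Dual R P))
        (N := ModuleCat.of R (Module.Dual R K)) g.dualMap f.dualMap := by
    intro K P M f g hs hM
    refine ⟨LinearMap.dualMap_injective_of_surjective hs.2.1, ?_, ?_⟩
    · intro φ
      exact ext_lift (ModuleCat.of R R) f g hs (hext1 M hM) φ
    · have hex : Function.Exact f g := LinearMap.exact_iff.2 hs.2.2
      ext ψ
      constructor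
      · intro hψ
        have hψ' : ∀ x, ψ (f x) = 0 := fun x => LinearMap.congr_fun hψ x
        have hle : LinearMap.range f ≤ LinearMap.ker (ψ : P →ₗ[R] R) := by
          rintro _ ⟨x, rfl⟩
          exact hψ' x
        refine ⟨(LinearMap.range f).liftQ ψ hle ∘ₗ (hex.linearEquivOfSurjective hs.2.1).symm, ?_⟩
        · refine LinearMap.ext fun p => ?_
          have : (hex.linearEquivOfSurjective hs.2.1).symm (g p) = Submodule.Quotient.mk p := by
            rw [LinearEquiv.symm_apply_eq]; rfl
          show (LinearMap.range f).liftQ ψ hle ((hex.linearEquivOfSurjective hs.2.1).symm (g p)) = _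
          rw [this]; rfl
      · rintro ⟨φ, rfl⟩
        refine LinearMap.ext fun x => ?_
        show φ (g (f x)) = 0
        rw [hex.apply_apply_eq_zero, map_zero]
  have hsurj : ∀ M, X M → Function.Surjective (Module.Dual.eval R M) := by
    intro M hM φ
    obtain ⟨K, P, f, g, hP, hs, hK⟩ := exists_cover X hX M hM
    have hP1 := hP.1
    have hP2 := hP.2
    obtain ⟨ψ, hψ⟩ := ext_lift (ModuleCat.of R R) _ _ (hdualses K P M f g hs hM)
      (hext1 _ (hdual K hK)) φ
    obtain ⟨p, rfl⟩ := (Module.bijective_dual_eval R P).2 ψ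
    exact ⟨g p, hψ⟩
  have hinj : ∀ M, X M → Function.Injective (Module.Dual.eval R M) := by
    intro M hM
    rw [injective_iff_map_eq_zero]
    intro m hm
    obtain ⟨K, P, f, g, hP, hs, hK⟩ := exists_cover X hX M hM
    have hP1 := hP.1
    have hP2 := hP.2
    obtain ⟨p, rfl⟩ := hs.2.1 m
    have hd := hdualses K P M f g hs hM
    -- `eval p` factors through `f.dualMap`
    have hker : ∀ ψ : Module.Dual R P, f.dualMap ψ = 0 → ψ p = 0 := by
      intro ψ hψ
      have : ψ ∈ LinearMap.range g.dualMap := by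
        have h := hd.2.2
        have h' : LinearMap.ker f.dualMap = LinearMap.range g.dualMap := h
        rw [← h']; exact hψ
      obtain ⟨χ, rfl⟩ := this
      exact LinearMap.congr_fun hm χ
    let φ : Module.Dual R (Module.Dual R K) :=
      (LinearMap.ker f.dualMap).liftQ (Module.Dual.eval R P p) (fun ψ hψ => hker ψ hψ) ∘ₗ
        (f.dualMap.quotKerEquivOfSurjective hd.2.1).symm
    have hφ : ∀ ψ : Module.Dual R P, φ (f.dualMap ψ) = ψ p := by
      intro ψ
      have : (f.dualMap.quotKerEquivOfSurjective hd.2.1).symm (f.dualMap ψ) =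
          Submodule.Quotient.mk ψ := by
        rw [LinearEquiv.symm_apply_eq]; rfl
      show (LinearMap.ker f.dualMap).liftQ (Module.Dual.eval R P p) (fun ψ hψ => hker ψ hψ)
        ((f.dualMap.quotKerEquivOfSurjective hd.2.1).symm (f.dualMap ψ)) = _
      rw [this]; rfl
    obtain ⟨k, hk⟩ := hsurj K hK φ
    have : p = f k := by
      apply (Module.bijective_dual_eval R P).1
      refine LinearMap.ext fun ψ => ?_
      show ψ p = ψ (f k)
      rw [← hφ, ← hk]; rfl
    have hmem : p ∈ LinearMap.ker g := by
      rw [hs.2.2, this]; exact ⟨k, rfl⟩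
    exact hmem
  intro M hM
  refine ⟨⟨hinj M hM, hsurj M hM⟩, ?_⟩
  intro i hi
  obtain ⟨n, rfl⟩ : ∃ n, i = n + 1 := ⟨i - 1, by omega⟩
  exact ⟨(extVanish_iff _ _ n).2 (hall n M hM), (extVanish_iff _ _ n).2 (hall n _ (hdual M hM))⟩
end
end
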